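/- arXiv:math/0304187 — 7 statements merged into one kernel-verified Lean document; each statement's English description precedes it below -/
import Mathlib

section
/- Let f : ℝ → ℂ be an even Schwartz function. The Mellin transform Mf(s) = ∫_0^∞ f(t) t^{s−1} dt, which converges absolutely and is holomorphic for Re s > 0, extends to a meromorphic function on the half-plane {Re s > −2} whose only singularity is a simple pole at s = 0 with residue f(0); explicitly, for −2 < Re s, s ≠ 0, the extension is given by Mf(s) = ∫_0^1 (f(t) − f(0)) t^{s−1} dt + f(0)/s + ∫_1^∞ f(t) t^{s−1} dt. -/
open Real Complex MeasureTheory Set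

open Filter Topology Asymptotics

/-- An even Schwartz function agrees with its value at the origin to second order. -/
lemma even_schwartz_taylor (f : SchwartzMap ℝ ℂ) (hf : ∀ x : ℝ, f (-x) = f x) :
    ∃ C : ℝ, ∀ x ∈ Icc (0 : ℝ) 1, ‖f x - f 0‖ ≤ C * x ^ 2 := by
  have hd : deriv f 0 = 0 := by
    have h1 : deriv (fun x => f (-x)) 0 = - deriv f (-0) := deriv_comp_neg f 0
    have h2 : (fun x => f (-x)) = f := funext hf
    rw [h2, neg_zero] at h1
    exact self_eq_neg.mp h1
  have hc : ContDiffOn ℝ ((1 : ℕ) + 1) f (Icc (0 : ℝ) 1) :=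
    (f.smooth ((1 : ℕ) + 1)).contDiffOn
  obtain ⟨C, hC⟩ := exists_taylor_mean_remainder_bound zero_le_one hc
  refine ⟨C, fun x hx => ?_⟩
  have h := hC x hx
  have hdw : derivWithin f (Icc (0 : ℝ) 1) 0 = 0 := by
    rw [f.differentiableAt.derivWithin
      (uniqueDiffOn_Icc zero_lt_one 0 (by simp)), hd]
  rw [show (1 : ℕ) = 0 + 1 from rfl, taylorWithinEval_succ, taylor_within_zero_eval] at h
  simpa [iteratedDerivWithin_one, hdw] using h

lemma schwartz_top (f : SchwartzMap ℝ ℂ) (a : ℝ) : f =O[atTop] (· ^ a : ℝ → ℝ) := by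
  have h := (f.isBigO_cocompact_rpow a).mono (atTop_le_cocompact)
  refine h.congr' EventuallyEq.rfl ?_
  filter_upwards [eventually_ge_atTop 0] with x hx
  simp [abs_of_nonneg hx]

lemma schwartz_zero (f : SchwartzMap ℝ ℂ) : f =O[𝓝[>] 0] (· ^ (-(0 : ℝ)) : ℝ → ℝ) := by
  have h : f =O[𝓝[>] 0] (fun _ => (1 : ℝ)) :=
    (f.continuous.tendsto 0).isBigO_one ℝ |>.mono nhdsWithin_le_nhds
  simpa using h

/-- The regularised function `f - f(0) 1_{(0,1]}`. -/
noncomputable def regPart (f : SchwartzMap ℝ ℂ) : ℝ → ℂ :=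
  fun t => f t - f 0 • (Ioc (0 : ℝ) 1).indicator (fun _ => (1 : ℂ)) t

lemma regPart_Ioc (f : SchwartzMap ℝ ℂ) {t : ℝ} (ht : t ∈ Ioc (0 : ℝ) 1) :
    regPart f t = f t - f 0 := by
  simp [regPart, indicator_of_mem ht]

lemma regPart_Ioi (f : SchwartzMap ℝ ℂ) {t : ℝ} (ht : t ∈ Ioi (1 : ℝ)) :
    regPart f t = f t := by
  have : t ∉ Ioc (0 : ℝ) 1 := fun h => absurd h.2 (not_le.mpr ht)
  simp [regPart, indicator_of_notMem this]

lemma regPart_loc (f : SchwartzMap ℝ ℂ) : LocallyIntegrableOn (regPart f) (Ioi 0) := by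
  have h1 : LocallyIntegrable f volume := f.continuous.locallyIntegrable
  have h2 : Integrable ((Ioc (0 : ℝ) 1).indicator (fun _ => (1 : ℂ))) volume := by
    rw [integrable_indicator_iff measurableSet_Ioc]
    exact integrableOn_const (by simp)
  exact (h1.sub (h2.smul (f 0)).locallyIntegrable).locallyIntegrableOn _

lemma regPart_top (f : SchwartzMap ℝ ℂ) (a : ℝ) : regPart f =O[atTop] (· ^ a : ℝ → ℝ) := by
  refine (schwartz_top f a).congr' ?_ EventuallyEq.rfl
  filter_upwards [eventually_gt_atTop 1] with x hx
  exact (regPart_Ioi f hx).symm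

lemma regPart_zero (f : SchwartzMap ℝ ℂ) (hf : ∀ x : ℝ, f (-x) = f x) :
    regPart f =O[𝓝[>] 0] (· ^ (-(-2 : ℝ)) : ℝ → ℝ) := by
  obtain ⟨C, hC⟩ := even_schwartz_taylor f hf
  refine IsBigO.of_bound C ?_
  filter_upwards [Ioc_mem_nhdsGT (zero_lt_one' ℝ)] with x hx
  rw [regPart_Ioc f hx, neg_neg, Real.rpow_two, Real.norm_of_nonneg (sq_nonneg x)]
  exact hC x (Ioc_subset_Icc_self hx)

/-- The Mellin transform `Mf(s) = ∫_0^∞ f(t) t^{s-1} dt` of an even Schwartz function: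
it converges absolutely and is holomorphic on `{Re s > 0}`, and it extends to
`{Re s > -2}` meromorphically, the only singularity being a simple pole at `s = 0`
with residue `f(0)`; explicitly the extension is
`∫_0^1 (f(t)-f(0)) t^{s-1} dt + f(0)/s + ∫_1^∞ f(t) t^{s-1} dt`. -/
theorem mellin_transform_even_schwartz_continuation (f : SchwartzMap ℝ ℂ)
    (hf : ∀ x : ℝ, f (-x) = f x) :
    (∀ s : ℂ, 0 < s.re →
      IntegrableOn (fun t : ℝ => f t * (t : ℂ) ^ (s - 1)) (Ioi 0)) ∧
    DifferentiableOn ℂ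
      (fun s : ℂ => ∫ t in Ioi (0 : ℝ), f t * (t : ℂ) ^ (s - 1)) {s : ℂ | 0 < s.re} ∧
    (∀ s : ℂ, -2 < s.re →
      IntegrableOn (fun t : ℝ => (f t - f 0) * (t : ℂ) ^ (s - 1)) (Ioc 0 1) ∧
      IntegrableOn (fun t : ℝ => f t * (t : ℂ) ^ (s - 1)) (Ioi 1)) ∧
    DifferentiableOn ℂ
      (fun s : ℂ => (∫ t in Ioc (0 : ℝ) 1, (f t - f 0) * (t : ℂ) ^ (s - 1))
        + ∫ t in Ioi (1 : ℝ), f t * (t : ℂ) ^ (s - 1)) {s : ℂ | -2 < s.re} ∧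
    (∀ s : ℂ, 0 < s.re →
      ∫ t in Ioi (0 : ℝ), f t * (t : ℂ) ^ (s - 1)
        = (∫ t in Ioc (0 : ℝ) 1, (f t - f 0) * (t : ℂ) ^ (s - 1))
          + f 0 / s + ∫ t in Ioi (1 : ℝ), f t * (t : ℂ) ^ (s - 1)) := by
  have key : ∀ s : ℂ, 0 < s.re → MellinConvergent f s := fun s hs =>
    mellinConvergent_of_isBigO_rpow (f.continuous.locallyIntegrable.locallyIntegrableOn _)
      (schwartz_top f (-(s.re + 1))) (by linarith) (schwartz_zero f) hs
  have keyg : ∀ s : ℂ, -2 < s.re → MellinConvergent (regPart f) s := fun s hs =>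
    mellinConvergent_of_isBigO_rpow (regPart_loc f)
      (regPart_top f (-(s.re + 1))) (by linarith) (regPart_zero f hf) hs
  have eM : ∀ s : ℂ, ∫ t in Ioi (0 : ℝ), f t * (t : ℂ) ^ (s - 1) = mellin f s := fun s => by
    simp only [mellin, smul_eq_mul, mul_comm]
  have c1 : ∀ s : ℂ, EqOn (fun t : ℝ => (t : ℂ) ^ (s - 1) • regPart f t)
      (fun t : ℝ => (f t - f 0) * (t : ℂ) ^ (s - 1)) (Ioc 0 1) := fun s t ht => by
    simp only [regPart_Ioc f ht, smul_eq_mul, mul_comm]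
  have c2 : ∀ s : ℂ, EqOn (fun t : ℝ => (t : ℂ) ^ (s - 1) • regPart f t)
      (fun t : ℝ => f t * (t : ℂ) ^ (s - 1)) (Ioi 1) := fun s t ht => by
    simp only [regPart_Ioi f ht, smul_eq_mul, mul_comm]
  have hsub : Ioi (1 : ℝ) ⊆ Ioi 0 := Ioi_subset_Ioi zero_le_one
  have eG : ∀ s : ℂ, -2 < s.re → mellin (regPart f) s =
      (∫ t in Ioc (0 : ℝ) 1, (f t - f 0) * (t : ℂ) ^ (s - 1))
        + ∫ t in Ioi (1 : ℝ), f t * (t : ℂ) ^ (s - 1) := fun s hs => by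
    have h := keyg s hs
    rw [MellinConvergent] at h
    rw [← setIntegral_congr_fun measurableSet_Ioc (c1 s),
      ← setIntegral_congr_fun measurableSet_Ioi (c2 s), mellin,
      ← Ioc_union_Ioi_eq_Ioi (zero_le_one' ℝ)]
    exact setIntegral_union Ioc_disjoint_Ioi_same measurableSet_Ioi
      (h.mono_set Ioc_subset_Ioi_self) (h.mono_set hsub)
  refine ⟨fun s hs => ?_, fun s hs => ?_, fun s hs => ⟨?_, ?_⟩, fun s hs => ?_, fun s hs => ?_⟩
  · have h := key s hs
    simpa only [MellinConvergent, smul_eq_mul, mul_comm] using h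
  · have h : DifferentiableAt ℂ (mellin f) s := mellin_differentiableAt_of_isBigO_rpow
      (f.continuous.locallyIntegrable.locallyIntegrableOn _)
      (schwartz_top f (-(s.re + 1))) (by linarith) (schwartz_zero f) hs
    simp only [eM]
    exact h.differentiableWithinAt
  · exact ((keyg s hs).mono_set Ioc_subset_Ioi_self).congr_fun (c1 s) measurableSet_Ioc
  · exact ((keyg s hs).mono_set hsub).congr_fun (c2 s) measurableSet_Ioi
  · have h : DifferentiableAt ℂ (mellin (regPart f)) s := mellin_differentiableAt_of_isBigO_rpow
      (regPart_loc f) (regPart_top f (-(s.re + 1))) (by linarith) (regPart_zero f hf) hs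
    exact h.differentiableWithinAt.congr (fun z hz => (eG z hz).symm) (eG s hs).symm
  · have h1 := hasMellin_one_Ioc hs
    have h2 := (hasMellin_sub (key s hs) (h1.1.const_smul (f 0))).2
    have h3 : mellin (regPart f) s = mellin f s - f 0 / s := by
      rw [mellin_const_smul, h1.2] at h2
      rw [smul_eq_mul, mul_one_div] at h2
      exact h2
    have h4 := eG s (by linarith)
    rw [eM]
    linear_combination h4 - h3
end

section
/- Let f : ℝ → ℂ be an even Schwartz function and let Mf(s) = ∫_0^∞ f(t) t^{s−1} dt be its Mellin transform. Then for every σ > 1, ∑_{n=1}^∞ f(n) = (1/2π) ∫_{−∞}^{∞} ζ(σ + it) Mf(σ + it) dt, where ζ is the Riemann zeta function; the integral converges absolutely. -/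
open Real Complex MeasureTheory Set

open Filter Topology Asymptotics in
theorem aux_top (f : SchwartzMap ℝ ℂ) (a : ℝ) : (f : ℝ → ℂ) =O[atTop] (fun t : ℝ => t ^ (-a)) := by
  have h := (f.isBigO_cocompact_rpow (-a)).mono atTop_le_cocompact
  refine h.trans (EventuallyEq.isBigO ?_)
  filter_upwards [eventually_gt_atTop 0] with t ht
  simp [abs_of_pos ht]

open Filter Topology Asymptotics in
theorem aux_bot (f : SchwartzMap ℝ ℂ) :
    (f : ℝ → ℂ) =O[𝓝[>] 0] (fun t : ℝ => t ^ (-(0:ℝ))) := by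
  have h : (f : ℝ → ℂ) =O[𝓝 0] (fun _ : ℝ => (1:ℝ)) :=
    f.continuous.continuousAt.isBigO_one ℝ
  simpa using h.mono nhdsWithin_le_nhds

theorem aux_loc (f : SchwartzMap ℝ ℂ) : LocallyIntegrableOn (f : ℝ → ℂ) (Ioi 0) :=
  f.continuous.locallyIntegrable.locallyIntegrableOn _

theorem aux_conv (f : SchwartzMap ℝ ℂ) {s : ℂ} (hs : 0 < s.re) : MellinConvergent f s :=
  mellinConvergent_of_isBigO_rpow (aux_loc f) (aux_top f (s.re + 1)) (by linarith) (aux_bot f) hs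

theorem aux_diff (f : SchwartzMap ℝ ℂ) {s : ℂ} (hs : 0 < s.re) :
    DifferentiableAt ℂ (mellin f) s :=
  mellin_differentiableAt_of_isBigO_rpow (aux_loc f) (aux_top f (s.re + 1)) (by linarith)
    (aux_bot f) hs

open Filter Topology Asymptotics in
theorem aux_ibp (f : SchwartzMap ℝ ℂ) {s : ℂ} (hs : 0 < s.re) :
    s * mellin f s = - mellin (SchwartzMap.derivCLM ℂ ℂ f) (s + 1) := by
  have hs0 : s ≠ 0 := by rintro rfl; simp at hs
  have h1 := aux_conv f hs
  have h2 := aux_conv (SchwartzMap.derivCLM ℂ ℂ f) (s := s + 1) (by simp; linarith)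
  unfold MellinConvergent at h1 h2
  have key := integral_Ioi_mul_deriv_eq_deriv_mul (a := 0) (u := f) (u' := SchwartzMap.derivCLM ℂ ℂ f)
    (v := fun t : ℝ => (t : ℂ) ^ s) (v' := fun t : ℝ => s * (t : ℂ) ^ (s - 1)) (a' := 0) (b' := 0)
    (fun x _ => f.hasDerivAt x)
    (fun x hx => hasDerivAt_ofReal_cpow_const (ne_of_gt hx) hs0)
    (by
      refine (h1.const_mul s).congr (ae_of_all _ fun t => ?_)
      simp only [smul_eq_mul, Pi.mul_apply]; ring)
    (by
      refine h2.congr (ae_of_all _ fun t => ?_)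
      simp only [smul_eq_mul, Pi.mul_apply, add_sub_cancel_right]; ring)
    (by
      have hc : ContinuousAt (fun t : ℝ => (t : ℂ) ^ s) 0 :=
        Complex.continuousAt_ofReal_cpow_const _ _ (Or.inl hs)
      have := (f.continuous.continuousAt (x := 0)).mul hc
      have h3 := this.tendsto.mono_left (nhdsWithin_le_nhds (s := Ioi (0:ℝ)))
      simpa [Complex.zero_cpow hs0] using h3)
    (by
      have hb : (fun t : ℝ => (t : ℂ) ^ s) =O[atTop] (fun t : ℝ => t ^ s.re) := by
        refine IsBigO.of_bound 1 ?_
        filter_upwards [eventually_gt_atTop 0] with t ht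
        rw [Complex.norm_cpow_eq_rpow_re_of_pos ht, one_mul]
        exact le_abs_self _
      have := (aux_top f (s.re + 1)).mul hb
      refine this.trans_tendsto ?_
      refine (tendsto_rpow_neg_atTop (zero_lt_one)).congr' ?_
      filter_upwards [eventually_gt_atTop 0] with t ht
      rw [← Real.rpow_add ht]; congr 1; ring)
  simp only [mellin, smul_eq_mul]
  rw [sub_self, zero_sub] at key
  rw [← integral_const_mul]
  have e1 : (∫ t in Ioi (0:ℝ), s * ((t : ℂ) ^ (s - 1) * f t)) =
      ∫ t in Ioi (0:ℝ), f t * (s * (t : ℂ) ^ (s - 1)) :=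
    integral_congr_ae (ae_of_all _ fun t => by ring)
  have e2 : (∫ t in Ioi (0:ℝ), (t : ℂ) ^ (s + 1 - 1) * SchwartzMap.derivCLM ℂ ℂ f t) =
      ∫ t in Ioi (0:ℝ), SchwartzMap.derivCLM ℂ ℂ f t * (t : ℂ) ^ s :=
    integral_congr_ae (ae_of_all _ fun t => by
      simp only [add_sub_cancel_right]; ring)
  rw [e1, e2, key]

theorem aux_norm (f : SchwartzMap ℝ ℂ) (s : ℂ) :
    ‖mellin f s‖ ≤ ∫ t in Ioi (0:ℝ), t ^ (s.re - 1) * ‖f t‖ := by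
  refine (norm_integral_le_integral_norm _).trans (le_of_eq ?_)
  refine setIntegral_congr_fun measurableSet_Ioi fun t ht => ?_
  simp only [norm_smul]
  rw [Complex.norm_cpow_eq_rpow_re_of_pos ht]; simp

theorem aux_bound (f : SchwartzMap ℝ ℂ) {σ : ℝ} (hσ : 1 < σ) :
    ∃ C : ℝ, ∀ t : ℝ, ‖mellin f (σ + t * I)‖ ≤ C * (1 + t ^ 2)⁻¹ := by
  let g := SchwartzMap.derivCLM ℂ ℂ (SchwartzMap.derivCLM ℂ ℂ f)
  refine ⟨∫ t in Ioi (0:ℝ), t ^ (σ + 1 + 1 - 1) * ‖g t‖, fun t => ?_⟩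
  set s : ℂ := σ + t * I with hs
  have hre : s.re = σ := by simp [hs]
  have him : s.im = t := by simp [hs]
  have e1 := aux_ibp f (s := s) (by linarith)
  have e2 := aux_ibp (SchwartzMap.derivCLM ℂ ℂ f) (s := s + 1) (by simp; linarith)
  have e3 : ((s + 1) * s) * mellin f s = mellin g (s + 1 + 1) := by
    rw [mul_assoc, e1, mul_neg, e2, neg_neg]
  have hn := aux_norm g (s + 1 + 1)
  rw [← e3, norm_mul, norm_mul] at hn
  simp only [add_re, one_re, hre] at hn
  have ha : √(1 + t ^ 2) ≤ ‖s‖ := by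
    rw [Complex.norm_def]; apply Real.sqrt_le_sqrt; rw [normSq_apply, hre, him]; nlinarith
  have hb : √(1 + t ^ 2) ≤ ‖s + 1‖ := by
    rw [Complex.norm_def]; apply Real.sqrt_le_sqrt; rw [normSq_apply]
    simp only [add_re, one_re, add_im, one_im, hre, him]; nlinarith
  have hp : 0 < 1 + t ^ 2 := by positivity
  have hab : 1 + t ^ 2 ≤ ‖s + 1‖ * ‖s‖ := by
    calc 1 + t ^ 2 = √(1 + t ^ 2) * √(1 + t ^ 2) := (Real.mul_self_sqrt hp.le).symm
      _ ≤ _ := by gcongr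
  rw [← div_eq_mul_inv, le_div_iff₀ hp, mul_comm]
  exact (mul_le_mul_of_nonneg_right hab (norm_nonneg _)).trans hn

theorem aux_line_cont (f : SchwartzMap ℝ ℂ) {σ : ℝ} (hσ : 1 < σ) :
    Continuous fun t : ℝ => mellin f (σ + t * I) := by
  rw [continuous_iff_continuousAt]
  intro t
  have := (aux_diff f (s := σ + t * I) (by simp; linarith)).continuousAt
  exact ContinuousAt.comp (f := fun t : ℝ => (σ : ℂ) + t * I) this (by fun_prop)

theorem aux_int (f : SchwartzMap ℝ ℂ) {σ : ℝ} (hσ : 1 < σ) :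
    Integrable fun t : ℝ => mellin f (σ + t * I) := by
  obtain ⟨C, hC⟩ := aux_bound f hσ
  exact (integrable_inv_one_add_sq.const_mul C).mono' (aux_line_cont f hσ).aestronglyMeasurable
    (ae_of_all _ hC)

theorem aux_term (σ t : ℝ) (n : ℕ) :
    ‖1 / ((n : ℂ) + 1) ^ ((σ : ℂ) + t * I)‖ = 1 / ((n : ℝ) + 1) ^ σ := by
  have : ((n : ℂ) + 1) = (((n : ℝ) + 1 : ℝ) : ℂ) := by push_cast; rfl
  rw [norm_div, norm_one, this, Complex.norm_cpow_eq_rpow_re_of_pos (by positivity)]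
  simp

theorem aux_summable {σ : ℝ} (hσ : 1 < σ) : Summable fun n : ℕ => 1 / ((n : ℝ) + 1) ^ σ := by
  have := (summable_nat_add_iff 1).2 (Real.summable_one_div_nat_rpow.2 hσ)
  simpa using this

/-- For an even Schwartz function `f` with Mellin transform `Mf`, and any `σ > 1`,
`∑_{n≥1} f(n) = (1/2π) ∫_ℝ ζ(σ+it) Mf(σ+it) dt`, the integral converging absolutely. -/
theorem sum_eq_contour_integral_zeta_mellin (f : SchwartzMap ℝ ℂ)
    (hf : ∀ x : ℝ, f (-x) = f x)
    (Mf : ℂ → ℂ) (hMf : ∀ s : ℂ, Mf s = ∫ t in Ioi (0 : ℝ), f t * (t : ℂ) ^ (s - 1))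
    (σ : ℝ) (hσ : 1 < σ) :
    Integrable (fun t : ℝ =>
      riemannZeta ((σ : ℂ) + t * Complex.I) * Mf ((σ : ℂ) + t * Complex.I)) ∧
    ∑' n : ℕ, f ((n : ℝ) + 1)
      = (1 / (2 * π) : ℝ) *
          ∫ t : ℝ, riemannZeta ((σ : ℂ) + t * Complex.I) * Mf ((σ : ℂ) + t * Complex.I) := by
  have hM : Mf = mellin f := by
    ext s
    rw [hMf, mellin]
    congr 1; ext t; rw [smul_eq_mul, mul_comm]
  subst hM
  have hint := aux_int f hσ
  have hz : ∀ t : ℝ, riemannZeta ((σ : ℂ) + t * I) =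
      ∑' n : ℕ, 1 / ((n : ℂ) + 1) ^ ((σ : ℂ) + t * I) := fun t =>
    zeta_eq_tsum_one_div_nat_add_one_cpow (by simpa using hσ)
  have hne : ∀ n : ℕ, ((n : ℂ) + 1) ≠ 0 := fun n => by exact_mod_cast Nat.succ_ne_zero n
  have htc : ∀ n : ℕ, Continuous fun t : ℝ => 1 / ((n : ℂ) + 1) ^ ((σ : ℂ) + t * I) := by
    intro n
    have h1 : Continuous fun t : ℝ => ((n : ℂ) + 1) ^ ((σ : ℂ) + t * I) :=
      Continuous.const_cpow (by fun_prop) (Or.inl (hne n))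
    exact continuous_const.div h1 fun t => by simp [Complex.cpow_eq_zero_iff, hne n]
  constructor
  · refine hint.bdd_mul (c := ∑' n : ℕ, 1 / ((n : ℝ) + 1) ^ σ) ?_ (ae_of_all _ fun t => ?_)
    · simp_rw [hz]
      exact (continuous_tsum htc (aux_summable hσ) fun n t =>
        (aux_term σ t n).le).aestronglyMeasurable
    · rw [hz]
      exact tsum_of_norm_bounded (aux_summable hσ).hasSum fun n => (aux_term σ t n).le
  · have hF : ∀ n : ℕ, Integrable fun t : ℝ =>
        1 / ((n : ℂ) + 1) ^ ((σ : ℂ) + t * I) * mellin f (σ + t * I) := fun n =>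
      hint.bdd_mul (htc n).aestronglyMeasurable (ae_of_all _ fun t => (aux_term σ t n).le)
    have key := (hasSum_integral_of_summable_integral_norm hF (by
      simp_rw [norm_mul, aux_term, integral_const_mul]
      exact (aux_summable hσ).mul_right _)).tsum_eq
    have hinv : ∀ n : ℕ, f ((n : ℝ) + 1) = (1 / (2 * π) : ℝ) *
        ∫ t : ℝ, 1 / ((n : ℂ) + 1) ^ ((σ : ℂ) + t * I) * mellin f (σ + t * I) := by
      intro n
      rw [← mellinInv_mellin_eq σ f (x := (n : ℝ) + 1) (by positivity)
        (aux_conv f (by simp; linarith)) hint f.continuous.continuousAt, mellinInv]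
      rw [Complex.real_smul]
      congr 2
      ext t
      rw [smul_eq_mul, Complex.cpow_neg, one_div]
      push_cast; rfl
    simp_rw [hinv]
    rw [tsum_mul_left, key]
    congr 2
    ext t
    rw [hz, tsum_mul_right]
end

section
/- Let f : ℝ → ℂ be an even Schwartz function, and for −2 < Re s, s ≠ 0, let Mf(s) = ∫_0^1 (f(t) − f(0)) t^{s−1} dt + f(0)/s + ∫_1^∞ f(t) t^{s−1} dt denote the meromorphic continuation of the Mellin transform ∫_0^∞ f(t) t^{s−1} dt. Then ∑_{n=1}^∞ f(n) − Mf(1) + f(0)/2 = (1/2π) ∫_{−∞}^{∞} ζ(−1 + it) Mf(−1 + it) dt, where ζ is the Riemann zeta function; the integral converges absolutely. -/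
open Real Complex MeasureTheory Set

section ZM
open Filter Topology Asymptotics

lemma zm_ibp (h h' : ℝ → ℂ) (s : ℂ) (hs : s ≠ 0)
    (hd : ∀ x ∈ Ioi (0:ℝ), HasDerivAt h (h' x) x)
    (h1 : MellinConvergent h s) (h2 : MellinConvergent h' (s + 1))
    (h0 : Tendsto (fun t : ℝ => (t : ℂ) ^ s * h t) (𝓝[>] 0) (𝓝 0))
    (hi : Tendsto (fun t : ℝ => (t : ℂ) ^ s * h t) atTop (𝓝 0)) :
    mellin h s = -(1 / s) * mellin h' (s + 1) := by
  have hu : ∀ x ∈ Ioi (0:ℝ), HasDerivAt (fun t : ℝ => (t : ℂ) ^ s) (s * (x : ℂ) ^ (s - 1)) x := by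
    intro x hx
    have := (hasDerivAt_ofReal_cpow_const' (ne_of_gt hx) (r := s - 1)
      (by intro hh; apply hs; linear_combination hh)).const_mul s
    simp only [sub_add_cancel] at this
    have e : (fun y : ℝ => s * ((y : ℂ) ^ s / s)) = fun t : ℝ => (t : ℂ) ^ s := by
      funext t; exact mul_div_cancel₀ _ hs
    rwa [e] at this
  unfold MellinConvergent at h1 h2
  simp only [add_sub_cancel_right] at h2
  have key := integral_Ioi_mul_deriv_eq_deriv_mul (a := (0:ℝ)) (a' := (0:ℂ)) (b' := (0:ℂ)) hu hd
    h2 (by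
      refine IntegrableOn.congr_fun (Integrable.const_mul h1 s) (fun x hx => ?_) measurableSet_Ioi
      simp only [Pi.mul_apply, smul_eq_mul, mul_assoc]) h0 hi
  have e1 : mellin h' (s + 1) = ∫ x in Ioi (0:ℝ), (x : ℂ) ^ s * h' x := by
    simp [mellin]
  have e2 : s * mellin h s = ∫ x in Ioi (0:ℝ), s * (x : ℂ) ^ (s - 1) * h x := by
    rw [mellin, ← integral_const_mul]
    simp [mul_assoc]
  rw [e1, key, ← e2]
  field_simp
  ring

lemma zm_conv (g : SchwartzMap ℝ ℂ) (w : ℂ) (hw : 0 < w.re) : MellinConvergent g w := by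
  refine mellinConvergent_of_isBigO_rpow (a := w.re + 1) (b := 0)
    (g.continuous.locallyIntegrable.locallyIntegrableOn _) ?_ (by linarith) ?_ hw
  · have := (g.isBigO_cocompact_rpow (-(w.re+1))).mono atTop_le_cocompact
    refine this.trans (IsBigO.of_bound 1 ?_)
    filter_upwards [eventually_gt_atTop 0] with t ht
    simp [abs_of_pos ht]
  · simp only [neg_zero, rpow_zero]
    exact (g.continuous.continuousAt.tendsto.mono_left nhdsWithin_le_nhds).isBigO_one ℝ

lemma zm_tend0 (g : ℝ → ℂ) (hg : ContinuousAt g 0) (w : ℂ) (hw : 0 < w.re) :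
    Tendsto (fun t : ℝ => (t : ℂ) ^ w * g t) (𝓝[>] 0) (𝓝 0) := by
  have h1 : Tendsto (fun t : ℝ => (t : ℂ) ^ w) (𝓝[>] 0) (𝓝 0) := by
    have := (continuousAt_ofReal_cpow_const 0 w (Or.inl hw)).tendsto.mono_left
      (nhdsWithin_le_nhds (s := Ioi 0))
    have hw0 : w ≠ 0 := by rintro rfl; simp at hw
    simpa [hw0] using this
  simpa using h1.mul (hg.tendsto.mono_left (nhdsWithin_le_nhds (s := Ioi 0)))

lemma zm_tendTop (g : SchwartzMap ℝ ℂ) (w : ℂ) :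
    Tendsto (fun t : ℝ => (t : ℂ) ^ w * g t) atTop (𝓝 0) := by
  have := (g.isBigO_cocompact_rpow (-(w.re+1))).mono atTop_le_cocompact
  have h2 : (fun t : ℝ => (t : ℂ) ^ w * g t) =O[atTop] (fun t : ℝ => t ^ w.re * ‖t‖ ^ (-(w.re+1))) := by
    refine IsBigO.mul (IsBigO.of_bound 1 ?_) this
    filter_upwards [eventually_gt_atTop 0] with t ht
    rw [Complex.norm_cpow_eq_rpow_re_of_pos ht, Real.norm_of_nonneg (by positivity), one_mul]
  refine h2.trans_tendsto ?_
  refine tendsto_inv_atTop_zero.congr' ?_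
  filter_upwards [eventually_gt_atTop 0] with t ht
  rw [Real.norm_of_nonneg ht.le, ← Real.rpow_add ht]
  simp [Real.rpow_neg_one]

lemma zm_mellin_deriv (g : SchwartzMap ℝ ℂ) (w : ℂ) (hw : 0 < w.re) :
    mellin g w = -(1 / w) * mellin (SchwartzMap.derivCLM ℝ ℂ g) (w + 1) := by
  refine zm_ibp _ _ w (by rintro rfl; simp at hw) (fun x _ => ?_) (zm_conv g w hw)
    (zm_conv _ _ (by simp; linarith)) (zm_tend0 _ g.continuous.continuousAt _ hw) (zm_tendTop _ _)
  exact g.hasDerivAt x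

lemma zm_vert (g : SchwartzMap ℝ ℂ) :
    Integrable (fun t : ℝ => mellin g ((2:ℝ) + t * Complex.I)) := by
  set G := SchwartzMap.derivCLM ℝ ℂ (SchwartzMap.derivCLM ℝ ℂ g) with hG
  set C := ∫ x in Ioi (0:ℝ), ‖((x:ℂ) ^ ((4:ℂ) - 1)) • G x‖ with hC
  have hC0 : 0 ≤ C := integral_nonneg fun _ => norm_nonneg _
  have hcont : Continuous (fun t : ℝ => mellin g ((2:ℝ) + t * Complex.I)) := by
    have hd : ∀ w : ℂ, 0 < w.re → ContinuousAt (mellin g) w := by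
      intro w hw
      refine (mellin_differentiableAt_of_isBigO_rpow (a := w.re + 1) (b := 0)
        (g.continuous.locallyIntegrable.locallyIntegrableOn _) ?_ (by linarith) ?_ hw).continuousAt
      · have := (g.isBigO_cocompact_rpow (-(w.re+1))).mono atTop_le_cocompact
        refine this.trans (IsBigO.of_bound 1 ?_)
        filter_upwards [eventually_gt_atTop 0] with t ht
        simp [abs_of_pos ht]
      · simp only [neg_zero, rpow_zero]
        exact (g.continuous.continuousAt.tendsto.mono_left nhdsWithin_le_nhds).isBigO_one ℝ
    rw [continuous_iff_continuousAt]
    intro t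
    exact ContinuousAt.comp (g := mellin g) (f := fun t : ℝ => ((2:ℝ) : ℂ) + t * Complex.I)
      (hd _ (by simp)) (by fun_prop)
  refine (integrable_inv_one_add_sq.const_mul C).mono' hcont.aestronglyMeasurable
    (Eventually.of_forall fun t => ?_)
  have hb : ‖mellin G ((2:ℝ) + t * Complex.I + 1 + 1)‖ ≤ C := by
    rw [mellin]
    refine (norm_integral_le_integral_norm _).trans_eq ?_
    refine setIntegral_congr_fun measurableSet_Ioi fun x hx => ?_
    simp only [norm_smul]
    rw [Complex.norm_cpow_eq_rpow_re_of_pos hx, Complex.norm_cpow_eq_rpow_re_of_pos hx]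
    norm_num
  rw [zm_mellin_deriv g _ (by simp), zm_mellin_deriv _ _ (by simp; norm_num)]
  have n1 : 1 + t^2 ≤ ‖((2:ℝ):ℂ) + t * Complex.I‖ * ‖((2:ℝ):ℂ) + t * Complex.I + 1‖ := by
    have a1 : √(1 + t^2) ≤ ‖((2:ℝ):ℂ) + t * Complex.I‖ := by
      rw [Complex.norm_add_mul_I]
      apply Real.sqrt_le_sqrt; nlinarith
    have a2 : √(1 + t^2) ≤ ‖((2:ℝ):ℂ) + t * Complex.I + 1‖ := by
      rw [show ((2:ℝ):ℂ) + t * Complex.I + 1 = ((3:ℝ):ℂ) + t * Complex.I by push_cast; ring,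
        Complex.norm_add_mul_I]
      apply Real.sqrt_le_sqrt; nlinarith
    calc 1 + t^2 = √(1 + t^2) * √(1 + t^2) := (Real.mul_self_sqrt (by positivity)).symm
      _ ≤ _ := by gcongr
  have n0 : 0 < 1 + t^2 := by positivity
  rw [norm_mul, norm_mul, norm_neg, norm_neg, norm_div, norm_div, norm_one, ← mul_assoc,
    div_mul_div_comm, one_mul, mul_comm]
  have : 1 / (‖((2:ℝ):ℂ) + t * Complex.I‖ * ‖((2:ℝ):ℂ) + t * Complex.I + 1‖) ≤ (1 + t^2)⁻¹ := by
    rw [one_div]; exact inv_anti₀ n0 n1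
  gcongr

noncomputable def zmK (u : ℝ) : ℂ := ((Real.cos (2 * π * u) - 1 : ℝ) : ℂ)

lemma zmK_cont : Continuous zmK := by unfold zmK; fun_prop

lemma zmK_conv (s : ℂ) (hs : s.re = -1) : MellinConvergent zmK s := by
  refine mellinConvergent_of_isBigO_rpow (a := 0) (b := -2)
    (zmK_cont.locallyIntegrable.locallyIntegrableOn _) ?_ (by linarith) ?_ (by linarith)
  · simp only [neg_zero, rpow_zero]
    refine IsBigO.of_bound 2 (Eventually.of_forall fun t => ?_)
    rw [zmK, Complex.norm_real, Real.norm_eq_abs, norm_one, abs_le]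
    constructor <;> nlinarith [Real.neg_one_le_cos (2*π*t), Real.cos_le_one (2*π*t)]
  · refine IsBigO.of_bound (2 * π^2) ?_
    filter_upwards [self_mem_nhdsWithin] with t ht
    have ht : 0 < t := ht
    rw [zmK, Complex.norm_real, Real.norm_eq_abs, neg_neg, Real.rpow_two, Real.norm_of_nonneg (by positivity), abs_le]
    constructor
    · nlinarith [Real.one_sub_sq_div_two_le_cos (x := 2*π*t)]
    · have : 0 ≤ 2 * π^2*t^2 := by positivity
      nlinarith [Real.cos_le_one (2*π*t)]

lemma zm_fubini (g : ℝ → ℂ) (hg : Continuous g)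
    (hg1 : IntegrableOn (fun y : ℝ => ‖g y‖ * y) (Ioi 0)) (s : ℂ) (hs : s.re = -1) :
    MellinConvergent (fun t => ∫ y in Ioi (0:ℝ), g y * zmK (y * t)) s ∧
    mellin (fun t => ∫ y in Ioi (0:ℝ), g y * zmK (y * t)) s
      = mellin zmK s * mellin g (1 - s) := by
  set H : ℝ × ℝ → ℂ := fun p => ((p.1 : ℂ) ^ (s - 1)) * (g p.2 * zmK (p.2 * p.1)) with hH
  have hmeas : Measurable H := by
    have h1 : Measurable (fun p : ℝ × ℝ => ((p.1 : ℂ) ^ (s - 1))) :=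
      (Complex.measurable_ofReal.comp measurable_fst).pow_const _
    have h2 : Continuous (fun p : ℝ × ℝ => g p.2 * zmK (p.2 * p.1)) :=
      (hg.comp continuous_snd).mul (zmK_cont.comp (continuous_snd.mul continuous_fst))
    exact h1.mul h2.measurable
  have hint : Integrable H ((volume.restrict (Ioi 0)).prod (volume.restrict (Ioi 0))) := by
    rw [integrable_prod_iff' hmeas.aestronglyMeasurable]
    constructor
    · filter_upwards [ae_restrict_mem measurableSet_Ioi] with y hy
      have := ((MellinConvergent.comp_mul_left (f := zmK) hy).2 (zmK_conv s hs))
      unfold MellinConvergent at this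
      refine (Integrable.const_mul this (g y)).congr (Eventually.of_forall fun t => ?_)
      simp only [hH, smul_eq_mul]; ring
    · set c := ∫ u in Ioi (0:ℝ), ‖(u:ℂ) ^ (s - 1) * zmK u‖ with hc
      refine IntegrableOn.congr_fun (Integrable.mul_const hg1 c) (fun y hy => ?_) measurableSet_Ioi
      have hy : 0 < y := hy
      have h3 := integral_comp_mul_left_Ioi (fun u : ℝ => ‖(u:ℂ) ^ (s - 1) * zmK u‖) 0 hy
      rw [mul_zero, ← hc] at h3
      have h4 : ∫ t in Ioi (0:ℝ), ‖H (t, y)‖ = ∫ t in Ioi (0:ℝ), (‖g y‖ * y^2) * ‖((y * t : ℝ):ℂ) ^ (s - 1) * zmK (y * t)‖ := by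
        refine setIntegral_congr_fun measurableSet_Ioi fun t ht => ?_
        have ht : 0 < t := ht
        simp only [hH, norm_mul]
        rw [Complex.norm_cpow_eq_rpow_re_of_pos ht, Complex.norm_cpow_eq_rpow_re_of_pos (mul_pos hy ht)]
        simp only [sub_re, hs, one_re]
        rw [show (-1 - 1 : ℝ) = -2 by norm_num, Real.rpow_neg ht.le, Real.rpow_neg (by positivity), Real.rpow_two, Real.rpow_two]
        field_simp
      rw [h4, integral_const_mul, h3, smul_eq_mul]
      field_simp
  constructor
  · refine hint.integral_prod_left.congr (Eventually.of_forall fun t => ?_)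
    simp only [hH, smul_eq_mul]
    rw [integral_const_mul]
  · have e1 : mellin (fun t => ∫ y in Ioi (0:ℝ), g y * zmK (y * t)) s
        = ∫ t in Ioi (0:ℝ), ∫ y in Ioi (0:ℝ), H (t, y) := by
      rw [mellin]
      congr 1; ext t
      simp only [hH, smul_eq_mul]
      rw [integral_const_mul]
    rw [e1, integral_integral_swap (f := fun t y => H (t,y)) hint, show mellin g (1 - s) = ∫ y in Ioi (0:ℝ), (y:ℂ) ^ (1 - s - 1) • g y from rfl,
      ← integral_const_mul]
    refine setIntegral_congr_fun measurableSet_Ioi fun y hy => ?_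
    have h5 := mellin_comp_mul_left zmK s (show (0:ℝ) < y from hy)
    simp only [hH, smul_eq_mul]
    rw [smul_eq_mul, mellin] at h5
    simp only [smul_eq_mul] at h5
    have : ∫ t in Ioi (0:ℝ), (t:ℂ) ^ (s - 1) * (g y * zmK (y * t)) = g y * ∫ t in Ioi (0:ℝ), (t:ℂ) ^ (s - 1) * zmK (y * t) := by
      rw [← integral_const_mul]; congr 1; ext t; ring
    rw [this, h5, show (1 - s - 1 : ℂ) = -s by ring]
    ring

lemma zm_even (h : ℝ → ℂ) (hi : Integrable h) (he : ∀ y, h (-y) = h y) :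
    ∫ y, h y = 2 * ∫ y in Ioi (0:ℝ), h y := by
  rw [← intervalIntegral.integral_Iic_add_Ioi (b := 0) hi.integrableOn hi.integrableOn]
  have := integral_comp_neg_Iic (0:ℝ) h
  simp only [he, neg_zero] at this
  rw [this]; ring

/-- from the Fourier representation -/
lemma zm_rep (F g : ℝ → ℂ) (hg : Continuous g) (hgi : Integrable g) (hge : ∀ y, g (-y) = g y)
    (hF : ∀ t : ℝ, F t = ∫ y : ℝ, Complex.exp (2 * π * (y * t) * Complex.I) * g y) (t : ℝ) :
    F t - F 0 = 2 * ∫ y in Ioi (0:ℝ), g y * zmK (y * t) := by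
  have bi : ∀ t : ℝ, Integrable (fun y : ℝ => Complex.exp (2 * π * (y * t) * Complex.I) * g y) := by
    intro t
    refine hgi.bdd_mul (c := 1) (by fun_prop) (Eventually.of_forall fun y => ?_)
    rw [show (2 * π * (y * t) * Complex.I : ℂ) = ((2 * π * (y * t) : ℝ) : ℂ) * Complex.I by push_cast; ring,
      Complex.norm_exp_ofReal_mul_I]
  have hneg : F t = ∫ y : ℝ, Complex.exp (-(2 * π * (y * t) * Complex.I)) * g y := by
    rw [hF, ← integral_neg_eq_self]
    congr 1; ext y; rw [hge]; push_cast; ring_nf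
  have bin : Integrable (fun y : ℝ => Complex.exp (-(2 * π * (y * t) * Complex.I)) * g y) := by
    have := (bi t).comp_neg
    refine this.congr (Eventually.of_forall fun y => ?_)
    simp only [hge]; push_cast; ring_nf
  have e2 : 2 * (F t - F 0) = 2 * ∫ y : ℝ, g y * zmK (y * t) := by
    have : 2 * (F t - F 0) = (F t - F 0) + (F t - F 0) := by ring
    rw [this]
    nth_rewrite 1 [hF t]
    rw [hneg, hF 0, ← integral_sub (bi t) (bi 0), ← integral_sub bin (bi 0), ← integral_add (f := fun y : ℝ => Complex.exp (2 * π * (y * t) * Complex.I) * g y - Complex.exp (2 * π * (y * (0:ℝ)) * Complex.I) * g y) (g := fun y : ℝ => Complex.exp (-(2 * π * (y * t) * Complex.I)) * g y - Complex.exp (2 * π * (y * (0:ℝ)) * Complex.I) * g y) ((bi t).sub (bi 0)) (bin.sub (bi 0)),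
      ← integral_const_mul]
    congr 1; ext y
    rw [zmK]
    push_cast
    rw [Complex.cos]
    simp only [mul_zero, zero_mul, Complex.exp_zero]
    ring_nf
  have e3 := mul_left_cancel₀ two_ne_zero e2
  rw [e3]
  refine zm_even (fun y => g y * zmK (y * t)) ?_ ?_
  · refine hgi.mul_bdd (c := 2) (zmK_cont.comp (by fun_prop)).aestronglyMeasurable
      (Eventually.of_forall fun y => ?_)
    rw [zmK, Complex.norm_real, Real.norm_eq_abs, abs_le]
    constructor <;> nlinarith [Real.neg_one_le_cos (2*π*(y*t)), Real.cos_le_one (2*π*(y*t))]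
  · intro y
    simp only [hge, zmK]
    rw [show 2 * π * (-y * t) = -(2 * π * (y * t)) by ring, Real.cos_neg]

lemma zm_gauss_pos (w : ℂ) (hw : 0 < w.re) :
    mellin (fun t : ℝ => Complex.exp (-π * t ^ 2)) w = (1 / 2) * Gammaℝ w := by
  have h1 := mellin_comp_rpow (fun u : ℝ => Complex.exp (-π * u)) w 2
  have h2 := Complex.integral_cpow_mul_exp_neg_mul_Ioi (a := w / 2) (r := π) (by simpa using hw) (pi_pos)
  have h3 : mellin (fun u : ℝ => Complex.exp (-π * u)) (w / 2) = (1 / (π:ℂ)) ^ (w / 2) * Complex.Gamma (w / 2) := by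
    rw [← h2, mellin]
    congr 1; ext t; simp
  have h4 : (fun t : ℝ => Complex.exp (-π * ((t ^ (2:ℝ) : ℝ) : ℂ))) = fun t : ℝ => Complex.exp (-π * t ^ 2) := by
    ext t; simp
  rw [h4] at h1
  push_cast at h1
  rw [h1, h3, Gammaℝ_def, neg_div, one_div, Complex.inv_cpow, ← Complex.cpow_neg]
  · simp
  · rw [Complex.arg_ofReal_of_nonneg pi_pos.le]; exact pi_pos.ne

lemma zm_gauss_expO (a : ℝ) : (fun t : ℝ => Complex.exp (-π * t ^ 2)) =O[atTop] (fun t : ℝ => t ^ (-a)) := by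
  have := (rexp_neg_quadratic_isLittleO_rpow_atTop (a := -π) (by simpa using pi_pos) 0 (-a)).isBigO
  refine IsBigO.trans (IsBigO.of_bound 1 (Eventually.of_forall fun t => ?_)) this
  rw [Complex.norm_exp]
  norm_cast
  simp

lemma zm_gauss_neg (s : ℂ) (hs : s.re = -1)
    (hc : MellinConvergent (fun t : ℝ => Complex.exp (-π * t ^ 2) - 1) s) :
    mellin (fun t : ℝ => Complex.exp (-π * t ^ 2) - 1) s = (1 / 2) * Gammaℝ s := by
  have hs0 : s ≠ 0 := by rintro rfl; simp at hs
  have hderiv : ∀ x : ℝ, HasDerivAt (fun t : ℝ => Complex.exp (-π * t ^ 2) - 1)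
      ((x : ℂ) ^ (1 : ℂ) • ((-2 * π : ℂ) • Complex.exp (-π * x ^ 2))) x := by
    intro x
    have h0 : HasDerivAt (fun z : ℂ => Complex.exp (-π * z ^ 2) - 1) (Complex.exp (-π * x ^ 2) * (-π * (2 * x))) (x : ℂ) := by
      have := ((((hasDerivAt_id (x:ℂ)).pow 2).const_mul (-π : ℂ)).cexp).sub_const 1
      simpa using this
    convert h0.comp_ofReal using 1
    simp; ring
  have hO := zm_gauss_expO
  have hconv : MellinConvergent (fun t : ℝ => Complex.exp (-π * t ^ 2)) (s + 1 + 1) := by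
    have hcont : Continuous (fun t : ℝ => Complex.exp (-π * t ^ 2)) := by fun_prop
    refine mellinConvergent_of_isBigO_rpow (a := 2) (b := 0)
      (hcont.locallyIntegrable.locallyIntegrableOn _) (hO 2) (by simp [hs]) ?_ (by simp [hs])
    simp only [neg_zero, rpow_zero]
    exact (hcont.continuousAt.tendsto.mono_left nhdsWithin_le_nhds).isBigO_one ℝ
  have := zm_ibp (fun t : ℝ => Complex.exp (-π * t ^ 2) - 1) _ s hs0 (fun x _ => hderiv x) hc
    (by
      rw [MellinConvergent.cpow_smul]
      exact hconv.const_smul _) ?_ ?_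
  · rw [this, mellin_cpow_smul, mellin_const_smul, zm_gauss_pos _ (by simp [hs]),
      show s + 1 + 1 = s + 2 by ring, Gammaℝ_add_two hs0]
    have : (π:ℂ) ≠ 0 := by simp [pi_ne_zero]
    simp only [smul_eq_mul]
    field_simp
  · -- bounded by π t
    have : Tendsto (fun t : ℝ => π * t) (𝓝[>] 0) (𝓝 0) := by
      have : Tendsto (fun t : ℝ => π * t) (𝓝 0) (𝓝 (π * 0)) := by
        exact (continuous_const.mul continuous_id).tendsto 0
      rw [mul_zero] at this
      exact this.mono_left nhdsWithin_le_nhds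
    refine squeeze_zero_norm' ?_ this
    filter_upwards [self_mem_nhdsWithin] with t ht
    have ht : 0 < t := ht
    rw [norm_mul, Complex.norm_cpow_eq_rpow_re_of_pos ht, hs, Real.rpow_neg_one]
    have : Complex.exp (-π * t ^ 2) - 1 = ((Real.exp (-π * t ^ 2) - 1 : ℝ) : ℂ) := by push_cast; rfl
    rw [this, Complex.norm_real, Real.norm_eq_abs, abs_of_nonpos]
    · have := Real.add_one_le_exp (-π * t ^ 2)
      rw [inv_mul_le_iff₀ ht]; nlinarith
    · have : Real.exp (-π * t ^ 2) ≤ 1 := Real.exp_le_one_iff.2 (by nlinarith [pi_pos, sq_nonneg t])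
      linarith
  · refine squeeze_zero_norm' ?_ tendsto_inv_atTop_zero
    filter_upwards [eventually_gt_atTop 0] with t ht
    rw [norm_mul, Complex.norm_cpow_eq_rpow_re_of_pos ht, hs, Real.rpow_neg_one]
    have : Complex.exp (-π * t ^ 2) - 1 = ((Real.exp (-π * t ^ 2) - 1 : ℝ) : ℂ) := by push_cast; rfl
    rw [this, Complex.norm_real, Real.norm_eq_abs]
    have h1 : Real.exp (-π * t ^ 2) ≤ 1 := Real.exp_le_one_iff.2 (by nlinarith [pi_pos, sq_nonneg t])
    have h2 := Real.exp_pos (-π * t ^ 2)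
    have : |Real.exp (-π * t ^ 2) - 1| ≤ 1 := by rw [abs_le]; constructor <;> linarith
    have h3 : 0 < t⁻¹ := by positivity
    nlinarith

/-- functional equation -/
lemma zm_FE (F g : ℝ → ℂ) (hg : Continuous g) (hgi : Integrable g) (hge : ∀ y, g (-y) = g y)
    (hg1 : IntegrableOn (fun y : ℝ => ‖g y‖ * y) (Ioi 0))
    (hF : ∀ t : ℝ, F t = ∫ y : ℝ, Complex.exp (2 * π * (y * t) * Complex.I) * g y)
    (s : ℂ) (hs : s.re = -1) :
    MellinConvergent (fun t => F t - F 0) s ∧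
    mellin (fun t => F t - F 0) s = 2 * mellin zmK s * mellin g (1 - s) := by
  obtain ⟨h1, h2⟩ := zm_fubini g hg hg1 s hs
  have e : (fun t => F t - F 0) = fun t => (2:ℂ) • ∫ y in Ioi (0:ℝ), g y * zmK (y * t) := by
    ext t; rw [zm_rep F g hg hgi hge hF, smul_eq_mul]
  rw [e]
  refine ⟨h1.const_smul _, ?_⟩
  rw [mellin_const_smul, h2, smul_eq_mul]; ring

lemma zmK_mellin (s : ℂ) (hs : s.re = -1) : 2 * mellin zmK s * Gammaℝ (1 - s) = Gammaℝ s := by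
  have hgc : Continuous (fun t : ℝ => Complex.exp (-π * t ^ 2)) := by fun_prop
  have hgi : Integrable (fun t : ℝ => Complex.exp (-π * t ^ 2)) := by
    exact integrable_cexp_neg_mul_sq (b := (π : ℂ)) (by simpa using pi_pos)
  have hg1 : IntegrableOn (fun y : ℝ => ‖Complex.exp (-π * y ^ 2)‖ * y) (Ioi 0) := by
    have := (integrable_mul_exp_neg_mul_sq (b := π) pi_pos).integrableOn (s := Ioi 0)
    refine this.congr_fun (fun y _ => ?_) measurableSet_Ioi
    simp only [Complex.norm_exp]
    norm_cast
    ring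
  obtain ⟨h1, h2⟩ := zm_FE (fun t : ℝ => Complex.exp (-π * t ^ 2)) (fun t : ℝ => Complex.exp (-π * t ^ 2))
    hgc hgi (by intro y; simp) hg1 (by
      intro t
      have := congrFun (fourier_gaussian_pi (b := 1) (by simp)) (-t)
      rw [Real.fourier_eq'] at this
      simp only [Complex.one_cpow, div_one, one_mul, mul_one] at this
      rw [show (Complex.exp (-π * t ^ 2)) = Complex.exp (-π * ((-t : ℝ):ℂ) ^ 2) by push_cast; rw [neg_sq], ← this]
      congr 1; ext y
      simp
      ring_nf) s hs
  simp only [ofReal_zero, ne_eq, OfNat.ofNat_ne_zero, not_false_eq_true, zero_pow, mul_zero, Complex.exp_zero] at h1 h2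
  rw [zm_gauss_neg s hs h1, zm_gauss_pos _ (by simp [hs])] at h2
  linear_combination -2 * h2

open scoped FourierTransform

lemma zm_sum (h : SchwartzMap ℝ ℂ) (he : ∀ x, h (-x) = h x) :
    ∑' n : ℤ, h n = h 0 + 2 * ∑' n : ℕ, h ((n : ℝ) + 1) := by
  have hs : Summable fun n : ℤ => h (n : ℝ) :=
    summable_of_isBigO (Real.summable_abs_int_rpow (b := 2) one_lt_two)
      ((h.isBigO_cocompact_rpow (-2)).comp_tendsto Int.tendsto_coe_cofinite)
  rw [tsum_int_eq_zero_add_two_mul_tsum_pnat (fun n => by push_cast; exact he _) hs]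
  have := tsum_pnat_eq_tsum_succ (f := fun n : ℕ => h (n : ℝ))
  push_cast at this ⊢
  rw [this]
  simp

lemma zm_inv (g : SchwartzMap ℝ ℂ) :
    Integrable (fun t : ℝ => riemannZeta ((2:ℝ) + t * Complex.I) * mellin g ((2:ℝ) + t * Complex.I)) ∧
    ∑' n : ℕ, g ((n : ℝ) + 1) = (1 / (2 * π) : ℝ) *
      ∫ t : ℝ, riemannZeta ((2:ℝ) + t * Complex.I) * mellin g ((2:ℝ) + t * Complex.I) := by
  have hv := zm_vert g
  set Mg : ℝ → ℂ := fun t : ℝ => mellin g ((2:ℝ) + t * Complex.I) with hMg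
  set Φ : ℕ → ℝ → ℂ := fun n t => (((n : ℝ) + 1 : ℝ) : ℂ) ^ (-(((2:ℝ):ℂ) + t * Complex.I)) * Mg t with hΦ
  have hnorm : ∀ (n : ℕ) (t : ℝ), ‖(((n : ℝ) + 1 : ℝ) : ℂ) ^ (-(((2:ℝ):ℂ) + t * Complex.I))‖ = 1 / ((n:ℝ) + 1) ^ 2 := by
    intro n t
    rw [Complex.norm_cpow_eq_rpow_re_of_pos (by positivity)]
    simp
  have hsum : Summable (fun n : ℕ => 1 / ((n:ℝ) + 1) ^ 2) := by
    have := (summable_nat_add_iff 1).2 (Real.summable_one_div_nat_pow (p := 2).2 one_lt_two)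
    simpa using this
  have hcont : ∀ n : ℕ, Continuous (fun t : ℝ => (((n : ℝ) + 1 : ℝ) : ℂ) ^ (-(((2:ℝ):ℂ) + t * Complex.I))) := by
    intro n
    refine Continuous.const_cpow (by fun_prop) (Or.inl ?_)
    exact_mod_cast (by positivity : ((n:ℝ) + 1) ≠ 0)
  have hΦi : ∀ n, Integrable (Φ n) := fun n =>
    hv.bdd_mul (c := 1 / ((n:ℝ) + 1) ^ 2) (hcont n).aestronglyMeasurable
      (Eventually.of_forall fun t => (hnorm n t).le)
  have hz : ∀ t : ℝ, riemannZeta ((2:ℝ) + t * Complex.I) * Mg t = ∑' n, Φ n t := by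
    intro t
    rw [zeta_eq_tsum_one_div_nat_add_one_cpow (by simp), ← tsum_mul_right]
    refine tsum_congr fun n => ?_
    simp only [hΦ]
    rw [Complex.cpow_neg, one_div]
    push_cast; rfl
  have hzc : Continuous (fun t : ℝ => riemannZeta ((2:ℝ) + t * Complex.I)) := by
    rw [continuous_iff_continuousAt]
    intro t
    refine ContinuousAt.comp (g := riemannZeta) (f := fun t : ℝ => ((2:ℝ) : ℂ) + t * Complex.I) ?_ (by fun_prop)
    refine (differentiableAt_riemannZeta ?_).continuousAt
    intro hh
    have := congrArg Complex.re hh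
    simp at this
  have hint : Integrable (fun t : ℝ => riemannZeta ((2:ℝ) + t * Complex.I) * Mg t) := by
    refine hv.bdd_mul (c := ∑' n : ℕ, 1 / ((n:ℝ) + 1) ^ 2) hzc.aestronglyMeasurable
      (Eventually.of_forall fun t => ?_)
    rw [zeta_eq_tsum_one_div_nat_add_one_cpow (by simp)]
    refine tsum_of_norm_bounded hsum.hasSum fun n => ?_
    rw [← hnorm n t, Complex.cpow_neg, one_div]
    push_cast; rfl
  refine ⟨hint, ?_⟩
  have hS := hasSum_integral_of_summable_integral_norm hΦi (by
    have : (fun n : ℕ => ∫ t, ‖Φ n t‖) = fun n : ℕ => 1 / ((n:ℝ) + 1) ^ 2 * ∫ t, ‖Mg t‖ := by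
      ext n
      rw [← integral_const_mul]
      congr 1; ext t
      simp only [hΦ, norm_mul, hnorm]
    rw [this]
    exact hsum.mul_right _)
  simp only [← hz] at hS
  rw [← hS.tsum_eq, ← tsum_mul_left]
  refine tsum_congr fun n => ?_
  have := mellinInv_mellin_eq 2 g (x := (n:ℝ) + 1) (by positivity) (zm_conv g _ (by simp)) hv
    g.continuous.continuousAt
  rw [← this, mellinInv, Complex.real_smul]
  rfl

lemma zm_main (f : SchwartzMap ℝ ℂ) (hf : ∀ x : ℝ, f (-x) = f x) (Mf : ℂ → ℂ)
    (hMf : ∀ s : ℂ, -2 < s.re → s ≠ 0 →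
      Mf s = (∫ t in Ioc (0 : ℝ) 1, (f t - f 0) * (t : ℂ) ^ (s - 1))
        + f 0 / s + ∫ t in Ioi (1 : ℝ), f t * (t : ℂ) ^ (s - 1)) :
    Integrable (fun t : ℝ =>
      riemannZeta (-1 + t * Complex.I) * Mf (-1 + t * Complex.I)) ∧
    (∑' n : ℕ, f ((n : ℝ) + 1)) - Mf 1 + f 0 / 2
      = (1 / (2 * π) : ℝ) *
          ∫ t : ℝ, riemannZeta (-1 + t * Complex.I) * Mf (-1 + t * Complex.I) := by
  set g : SchwartzMap ℝ ℂ := 𝓕 f with hg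
  have hgv : ∀ y : ℝ, g y = ∫ v : ℝ, Complex.exp (((-2 * π * (v * y) : ℝ) : ℂ) * Complex.I) * f v := by
    intro y
    rw [hg, SchwartzMap.fourier_coe, Real.fourier_eq']
    simp [mul_comm]
  have hge : ∀ y, g (-y) = g y := by
    intro y
    rw [hgv, hgv, ← integral_neg_eq_self]
    congr 1; ext v; rw [hf]; ring_nf
  have hfv : ∀ t : ℝ, f t = ∫ y : ℝ, Complex.exp (2 * π * (y * t) * Complex.I) * g y := by
    intro t
    have h1 : 𝓕⁻ g = f := by rw [hg]; exact FourierTransform.fourierInv_fourier_eq f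
    conv_lhs => rw [← h1]
    rw [SchwartzMap.fourierInv_coe, Real.fourierInv_eq']
    simp [mul_comm]
  have hg1 : IntegrableOn (fun y : ℝ => ‖g y‖ * y) (Ioi 0) := by
    have := (g.integrable_pow_mul volume 1).integrableOn (s := Ioi 0)
    refine this.congr_fun (fun y hy => ?_) measurableSet_Ioi
    have hy : 0 < y := hy
    simp [abs_of_pos hy, mul_comm]
  -- functional equation
  have hFE : ∀ s : ℂ, s.re = -1 → riemannZeta s * Mf s = riemannZeta (1 - s) * mellin g (1 - s) := by
    intro s hs
    have hs0 : s ≠ 0 := by rintro rfl; simp at hs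
    have hs1 : 1 - s ≠ 0 := by
      intro hh
      have := congrArg Complex.re hh
      simp [hs] at this
    obtain ⟨c1, c2⟩ := zm_FE f g g.continuous g.integrable hge hg1 hfv s hs
    have hM : Mf s = mellin (fun t => f t - f 0) s := by
      rw [hMf s (by rw [hs]; norm_num) hs0, mellin]
      unfold MellinConvergent at c1
      have hU : Ioi (0:ℝ) = Ioc 0 1 ∪ Ioi 1 := (Ioc_union_Ioi_eq_Ioi zero_le_one).symm
      have i1 : IntegrableOn (fun t : ℝ => (t:ℂ) ^ (s - 1) • (f t - f 0)) (Ioc 0 1) :=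
        IntegrableOn.mono_set c1 Ioc_subset_Ioi_self
      have i2 : IntegrableOn (fun t : ℝ => (t:ℂ) ^ (s - 1) • (f t - f 0)) (Ioi 1) :=
        IntegrableOn.mono_set c1 (Ioi_subset_Ioi zero_le_one)
      have i3 : IntegrableOn (fun t : ℝ => (t:ℂ) ^ (s - 1) * f 0) (Ioi 1) :=
        Integrable.mul_const (integrableOn_Ioi_cpow_of_lt (by simp [hs]) one_pos) _
      rw [hU, setIntegral_union Ioc_disjoint_Ioi_same measurableSet_Ioi i1 i2]
      have e1 : ∫ t in Ioi (1:ℝ), f t * (t : ℂ) ^ (s - 1)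
          = (∫ t in Ioi (1:ℝ), (t:ℂ) ^ (s - 1) • (f t - f 0)) + ∫ t in Ioi (1:ℝ), (t:ℂ) ^ (s - 1) * f 0 := by
        rw [← integral_add i2 i3]
        congr 1; ext t; simp only [smul_eq_mul]; ring
      have e2 : ∫ t in Ioi (1:ℝ), (t:ℂ) ^ (s - 1) * f 0 = - (f 0 / s) := by
        rw [integral_mul_const, integral_Ioi_cpow_of_lt (by simp [hs]) one_pos]
        simp
        field_simp
      rw [e1, e2]
      simp only [smul_eq_mul, mul_comm]
      ring
    have hK := zmK_mellin s hs
    have hG1 : Gammaℝ (1 - s) ≠ 0 := Gammaℝ_ne_zero_of_re_pos (by simp [hs])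
    have hG0 : Gammaℝ s ≠ 0 := by
      rw [Ne, Gammaℝ_eq_zero_iff]
      rintro ⟨n, hn⟩
      have := congrArg Complex.re hn
      simp [hs] at this
      have h2 : (1:ℤ) = 2 * n := by exact_mod_cast this
      omega
    rw [hM, c2, riemannZeta_def_of_ne_zero hs0, riemannZeta_def_of_ne_zero hs1,
      completedRiemannZeta_one_sub]
    field_simp
    linear_combination completedRiemannZeta s * mellin g (1 - s) * hK
  obtain ⟨j1, j2⟩ := zm_inv g
  have hfun : (fun t : ℝ => riemannZeta (-1 + t * Complex.I) * Mf (-1 + t * Complex.I))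
      = fun t : ℝ => (fun t : ℝ => riemannZeta ((2:ℝ) + t * Complex.I) * mellin g ((2:ℝ) + t * Complex.I)) (-t) := by
    ext t
    rw [hFE _ (by simp)]
    rw [show (1 - (-1 + t * Complex.I) : ℂ) = (2:ℝ) + ((-t : ℝ) : ℂ) * Complex.I by push_cast; ring]
  rw [hfun]
  refine ⟨j1.comp_neg, ?_⟩
  rw [integral_neg_eq_self (fun t : ℝ => riemannZeta ((2:ℝ) + t * Complex.I) * mellin g ((2:ℝ) + t * Complex.I)), ← j2]
  -- Poisson
  have hP := SchwartzMap.tsum_eq_tsum_fourier f 0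
  have hP' : ∑' n : ℤ, f n = ∑' n : ℤ, g n := by
    simpa [fourier_eval_zero] using hP
  rw [zm_sum f hf, zm_sum g hge] at hP'
  have hg0 : g 0 = 2 * ∫ t in Ioi (0:ℝ), f t := by
    rw [← zm_even f f.integrable hf, hgv]; simp
  have hM1 : Mf 1 = ∫ t in Ioi (0:ℝ), f t := by
    rw [hMf 1 (by norm_num) one_ne_zero]
    have hU : Ioi (0:ℝ) = Ioc 0 1 ∪ Ioi 1 := (Ioc_union_Ioi_eq_Ioi zero_le_one).symm
    rw [hU, setIntegral_union Ioc_disjoint_Ioi_same measurableSet_Ioi f.integrable.integrableOn f.integrable.integrableOn]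
    simp only [sub_self, Complex.cpow_zero, mul_one, div_one]
    rw [integral_sub f.integrable.integrableOn (by simp)]
    simp
  rw [hM1]
  linear_combination (1/2) * hP' + (1/2) * hg0

end ZM

/-- For an even Schwartz function `f`, with `Mf` the meromorphic continuation of its
Mellin transform given by `Mf(s) = ∫_0^1 (f(t)-f(0)) t^{s-1} dt + f(0)/s + ∫_1^∞ f(t) t^{s-1} dt`,
one has `∑_{n≥1} f(n) - Mf(1) + f(0)/2 = (1/2π) ∫_ℝ ζ(-1+it) Mf(-1+it) dt`,
the integral converging absolutely. -/
theorem shifted_contour_integral_zeta_mellin (f : SchwartzMap ℝ ℂ)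
    (hf : ∀ x : ℝ, f (-x) = f x)
    (Mf : ℂ → ℂ)
    (hMf : ∀ s : ℂ, -2 < s.re → s ≠ 0 →
      Mf s = (∫ t in Ioc (0 : ℝ) 1, (f t - f 0) * (t : ℂ) ^ (s - 1))
        + f 0 / s + ∫ t in Ioi (1 : ℝ), f t * (t : ℂ) ^ (s - 1)) :
    Integrable (fun t : ℝ =>
      riemannZeta (-1 + t * Complex.I) * Mf (-1 + t * Complex.I)) ∧
    (∑' n : ℕ, f ((n : ℝ) + 1)) - Mf 1 + f 0 / 2
      = (1 / (2 * π) : ℝ) *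
          ∫ t : ℝ, riemannZeta (-1 + t * Complex.I) * Mf (-1 + t * Complex.I) := by
  exact zm_main f hf Mf hMf
end

section
/- For all s ∈ ℂ with 0 < Re s < 1, the improper integral ∫_ℝ cos(2πx) |x|^{s−1} dx, interpreted as lim_{T→∞} ∫_{−T}^{T} cos(2πx) |x|^{s−1} dx (equivalently 2·lim_{T→∞} ∫_0^T cos(2πx) x^{s−1} dx), exists and equals π^{−s/2} Γ(s/2) / (π^{(s−1)/2} Γ((1−s)/2)). -/
open Real Complex MeasureTheory Set Filter

lemma aux_gauss_cos {u : ℝ} (hu : 0 < u) :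
    Integrable (fun x : ℝ => Real.cos (2 * π * x) * Real.exp (-(π * u) * x ^ 2)) ∧
    ∫ x : ℝ, Real.cos (2 * π * x) * Real.exp (-(π * u) * x ^ 2)
      = u ^ (-(1 / 2) : ℝ) * Real.exp (-(π / u)) := by
  have hb : 0 < π * u := by positivity
  have hint : Integrable (fun x : ℝ => cexp (I * ((2 * π : ℝ) : ℂ) * x) *
      cexp (-((π * u : ℝ) : ℂ) * x ^ 2)) := by
    refine (integrable_exp_neg_mul_sq hb).mono' ?_ ?_
    · fun_prop
    · refine Eventually.of_forall fun x => le_of_eq ?_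
      rw [norm_mul, Complex.norm_exp, Complex.norm_exp]
      have h1 : (I * ((2 * π : ℝ) : ℂ) * x).re = 0 := by simp
      have h2 : (-((π * u : ℝ) : ℂ) * (x : ℂ) ^ 2).re = -(π * u) * x ^ 2 := by
        rw [show (-((π * u : ℝ) : ℂ) * (x : ℂ) ^ 2) = ((-(π * u) * x ^ 2 : ℝ) : ℂ) by push_cast; ring]
        exact ofReal_re _
      rw [h1, h2]; simp
  have hre : ∀ x : ℝ, RCLike.re (cexp (I * ((2 * π : ℝ) : ℂ) * x) *
      cexp (-((π * u : ℝ) : ℂ) * x ^ 2)) = Real.cos (2 * π * x) * Real.exp (-(π * u) * x ^ 2) := by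
    intro x
    rw [show (-((π * u : ℝ) : ℂ) * (x : ℂ) ^ 2) = ((-(π * u) * x ^ 2 : ℝ) : ℂ) by push_cast; ring,
      show I * ((2 * π : ℝ) : ℂ) * x = ((2 * π * x : ℝ) : ℂ) * I by push_cast; ring,
      ← ofReal_exp]
    show (_ * _ : ℂ).re = _
    rw [re_mul_ofReal, exp_ofReal_mul_I_re]
  have hi := hint.re
  simp only [hre] at hi
  refine ⟨hi, ?_⟩
  have h := fourierIntegral_gaussian (b := ((π * u : ℝ) : ℂ)) (by simpa using hb) ((2 * π : ℝ) : ℂ)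
  have h2 := congrArg RCLike.re h
  rw [← integral_re hint] at h2
  simp only [hre] at h2
  rw [h2]
  have e1 : ((π : ℂ) / ((π * u : ℝ) : ℂ)) ^ (1 / 2 : ℂ) = ((u ^ (-(1 / 2) : ℝ) : ℝ) : ℂ) := by
    rw [show ((π : ℂ) / ((π * u : ℝ) : ℂ)) = ((u⁻¹ : ℝ) : ℂ) by
      push_cast; have := Real.pi_ne_zero; field_simp]
    rw [show (1 / 2 : ℂ) = ((1 / 2 : ℝ) : ℂ) by push_cast; ring, ← ofReal_cpow (by positivity),
      Real.rpow_neg hu.le, Real.inv_rpow hu.le]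
  have e2 : cexp (-((2 * π : ℝ) : ℂ) ^ 2 / (4 * ((π * u : ℝ) : ℂ))) =
      ((Real.exp (-(π / u)) : ℝ) : ℂ) := by
    rw [ofReal_exp]
    congr 1
    push_cast
    have : (π : ℂ) ≠ 0 := by exact_mod_cast Real.pi_ne_zero
    have : (u : ℂ) ≠ 0 := by exact_mod_cast hu.ne'
    field_simp
    ring
  rw [e1, e2, ← ofReal_mul]
  exact ofReal_re _

lemma aux_gauss_sin {u : ℝ} (hu : 0 < u) :
    ∫ x in Ioi (0 : ℝ), x * Real.sin (2 * π * x) * Real.exp (-(π * u) * x ^ 2)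
      = 1 / 2 * u ^ (-(3 / 2) : ℝ) * Real.exp (-(π / u)) := by
  have hb : 0 < π * u := by positivity
  obtain ⟨hc, hv⟩ := aux_gauss_cos hu
  have hs : Integrable (fun x : ℝ => x * Real.sin (2 * π * x) * Real.exp (-(π * u) * x ^ 2)) := by
    refine (integrable_mul_exp_neg_mul_sq hb).mono ?_ ?_
    · fun_prop
    · refine Eventually.of_forall fun x => ?_
      simp only [norm_mul, Real.norm_eq_abs]
      gcongr
      exact mul_le_of_le_one_right (abs_nonneg _) (Real.abs_sin_le_one _)
  have hd : ∀ x : ℝ, HasDerivAt (fun x => Real.sin (2 * π * x) * Real.exp (-(π * u) * x ^ 2))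
      (2 * π * (Real.cos (2 * π * x) * Real.exp (-(π * u) * x ^ 2)) -
       2 * π * u * (x * Real.sin (2 * π * x) * Real.exp (-(π * u) * x ^ 2))) x := by
    intro x
    have h1 : HasDerivAt (fun x => Real.sin (2 * π * x)) (Real.cos (2 * π * x) * (2 * π * 1)) x :=
      ((hasDerivAt_id x).const_mul (2 * π)).sin
    have h2 : HasDerivAt (fun x => Real.exp (-(π * u) * x ^ 2))
        (Real.exp (-(π * u) * x ^ 2) * (-(π * u) * (2 * x))) x := by
      have := ((hasDerivAt_pow 2 x).const_mul (-(π * u))).exp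
      simpa using this
    refine (h1.mul h2).congr_deriv ?_
    ring
  have hlim : Tendsto (fun x => Real.sin (2 * π * x) * Real.exp (-(π * u) * x ^ 2)) atTop (nhds 0) := by
    have h0 : Tendsto (fun x : ℝ => Real.exp (-(π * u) * x ^ 2)) atTop (nhds 0) := by
      refine Real.tendsto_exp_atBot.comp ?_
      exact (tendsto_pow_atTop (two_ne_zero)).const_mul_atTop_of_neg (by linarith)
    refine squeeze_zero_norm (fun x => ?_) h0
    rw [norm_mul, Real.norm_eq_abs, Real.norm_eq_abs, abs_of_pos (Real.exp_pos _)]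
    exact mul_le_of_le_one_left (Real.exp_pos _).le (Real.abs_sin_le_one _)
  have key := integral_Ioi_of_hasDerivAt_of_tendsto (a := 0) (hd 0).continuousAt.continuousWithinAt
    (fun x _ => hd x) ((hc.const_mul _).sub (hs.const_mul _)).integrableOn hlim
  rw [integral_sub (hc.const_mul _).integrableOn (hs.const_mul _).integrableOn,
    integral_const_mul, integral_const_mul] at key
  have hab := integral_comp_abs (f := fun x => Real.cos (2 * π * x) * Real.exp (-(π * u) * x ^ 2))
  have : ∀ x : ℝ, Real.cos (2 * π * |x|) = Real.cos (2 * π * x) := by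
    intro x
    rcases abs_choice x with h | h <;> rw [h]
    rw [mul_neg, Real.cos_neg]
  simp only [this, sq_abs] at hab
  rw [hv] at hab
  have hu32 : u ^ (-(3 / 2) : ℝ) * u = u ^ (-(1 / 2) : ℝ) := by
    rw [← Real.rpow_add_one hu.ne']; norm_num
  rw [← hu32] at hab
  simp only [mul_zero, Real.sin_zero, zero_mul, sub_zero] at key
  have hpi := Real.pi_pos
  set A := ∫ x in Ioi (0 : ℝ), x * Real.sin (2 * π * x) * Real.exp (-(π * u) * x ^ 2)
  set B := ∫ x in Ioi (0 : ℝ), Real.cos (2 * π * x) * Real.exp (-(π * u) * x ^ 2)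
  have h3 : (2 * π * u) * A = (2 * π * u) * (1 / 2 * u ^ (-(3 / 2) : ℝ) * Real.exp (-(π / u))) := by
    linear_combination -key - π * hab
  exact mul_left_cancel₀ (by positivity) h3

lemma aux_int_s6 {r : ℝ} (h0 : 0 < r) (h1 : r < 1) :
    IntegrableOn (fun x : ℝ => |Real.sin (2 * π * x)| * x ^ (r - 2)) (Ioi 0) := by
  have hm : Measurable (fun x : ℝ => |Real.sin (2 * π * x)| * x ^ (r - 2)) := by fun_prop
  rw [← Ioc_union_Ioi_eq_Ioi (zero_le_one' ℝ), integrableOn_union]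
  constructor
  · have h := ((intervalIntegral.intervalIntegrable_rpow' (a := 0) (b := 1)
      (show -1 < r - 1 by linarith)).1).const_mul (2 * π)
    refine Integrable.mono' h hm.aestronglyMeasurable ?_
    refine (ae_restrict_iff' measurableSet_Ioc).2 (Eventually.of_forall fun x hx => ?_)
    have hx0 : 0 < x := hx.1
    rw [Real.norm_eq_abs, abs_of_nonneg (by positivity)]
    have : |Real.sin (2 * π * x)| ≤ 2 * π * x := by
      refine Real.abs_sin_le_abs.trans ?_
      rw [abs_of_pos (by positivity)]
    calc _ ≤ 2 * π * x * x ^ (r - 2) := by gcongr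
      _ = 2 * π * x ^ (r - 1) := by
        rw [show r - 1 = r - 2 + 1 by ring, Real.rpow_add_one hx0.ne']; ring
  · refine Integrable.mono' (integrableOn_Ioi_rpow_of_lt (show r - 2 < -1 by linarith) one_pos)
      hm.aestronglyMeasurable ?_
    refine (ae_restrict_iff' measurableSet_Ioi).2 (Eventually.of_forall fun x hx => ?_)
    have hx0 : 0 < x := one_pos.trans hx
    rw [Real.norm_eq_abs, abs_of_nonneg (by positivity)]
    exact mul_le_of_le_one_left (by positivity) (Real.abs_sin_le_one _)

lemma aux_int_c {s : ℂ} (hs0 : 0 < s.re) (hs1 : s.re < 1) :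
    IntegrableOn (fun x : ℝ => (Real.sin (2 * π * x) : ℂ) * (x : ℂ) ^ (s - 2)) (Ioi 0) := by
  refine Integrable.mono' (aux_int_s6 hs0 hs1) (Measurable.aestronglyMeasurable (by fun_prop)) ?_
  refine (ae_restrict_iff' measurableSet_Ioi).2 (Eventually.of_forall fun x hx => ?_)
  rw [norm_mul, norm_cpow_eq_rpow_re_of_pos hx, norm_real, Real.norm_eq_abs]
  simp

lemma aux_pow {x : ℝ} (hx : 0 < x) (s : ℂ) :
    (1 / ((π * x ^ 2 : ℝ) : ℂ)) ^ ((3 - s) / 2) =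
      (π : ℂ) ^ (-((3 - s) / 2)) * (x : ℂ) ^ (s - 3) := by
  have hx' : (x : ℂ) ≠ 0 := by exact_mod_cast hx.ne'
  have hp' : (π : ℂ) ≠ 0 := by exact_mod_cast Real.pi_ne_zero
  have hn : (1 / ((π * x ^ 2 : ℝ) : ℂ)) ≠ 0 := by
    exact one_div_ne_zero (by exact_mod_cast (show (0 : ℝ) < π * x ^ 2 by positivity).ne')
  rw [cpow_def_of_ne_zero hn, cpow_def_of_ne_zero hp', cpow_def_of_ne_zero hx', ← Complex.exp_add]
  congr 1
  rw [← ofReal_one, ← ofReal_div, ← ofReal_log (by positivity), ← ofReal_log hx.le,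
    ← ofReal_log Real.pi_pos.le, one_div, Real.log_inv, Real.log_mul (by positivity) (by positivity),
    Real.log_pow]
  push_cast
  ring

lemma aux_J {s : ℂ} (hs0 : 0 < s.re) (hs1 : s.re < 1) :
    (π : ℂ) ^ (-((3 - s) / 2)) * Complex.Gamma ((3 - s) / 2) *
      ∫ x in Ioi (0 : ℝ), (Real.sin (2 * π * x) : ℂ) * (x : ℂ) ^ (s - 2)
    = 1 / 2 * ((π : ℂ) ^ (-s / 2) * Complex.Gamma (s / 2)) := by
  have hare : ((3 - s) / 2).re = (3 - s.re) / 2 := by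
    simp
  have ha : 0 < ((3 - s) / 2).re := by rw [hare]; linarith
  set g : ℝ → ℝ → ℂ := fun x u => ((x * Real.sin (2 * π * x) : ℝ) : ℂ) *
    ((u : ℂ) ^ ((3 - s) / 2 - 1) * cexp (-(((π * x ^ 2 : ℝ) : ℂ) * u))) with hg
  have hgm : Measurable (Function.uncurry g) := by
    simp only [hg, Function.uncurry_def]; fun_prop
  have hnorm : ∀ x > (0 : ℝ), ∀ u > (0 : ℝ), ‖g x u‖ = x * |Real.sin (2 * π * x)| *
      (u ^ ((3 - s.re) / 2 - 1) * Real.exp (-((π * x ^ 2) * u))) := by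
    intro x hx u hu
    simp only [hg]
    rw [norm_mul, norm_mul, norm_cpow_eq_rpow_re_of_pos hu, norm_real, norm_mul, Real.norm_eq_abs,
      Real.norm_eq_abs, abs_of_pos hx, ← ofReal_mul, ← ofReal_neg, ← ofReal_exp, norm_real,
      Real.norm_eq_abs, abs_of_pos (Real.exp_pos _), sub_re, hare, one_re]
  have hinner : ∀ x > (0 : ℝ), ∫ u in Ioi (0 : ℝ), g x u =
      (π : ℂ) ^ (-((3 - s) / 2)) * Complex.Gamma ((3 - s) / 2) *
        ((Real.sin (2 * π * x) : ℂ) * (x : ℂ) ^ (s - 2)) := by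
    intro x hx
    have hx' : (x : ℂ) ≠ 0 := by exact_mod_cast hx.ne'
    simp only [hg]
    rw [integral_const_mul, Complex.integral_cpow_mul_exp_neg_mul_Ioi ha (by positivity),
      aux_pow hx, show s - 2 = s - 3 + 1 by ring, cpow_add _ _ hx', cpow_one]
    push_cast
    ring
  have hint : Integrable (Function.uncurry g)
      ((volume.restrict (Ioi (0 : ℝ))).prod (volume.restrict (Ioi (0 : ℝ)))) := by
    rw [integrable_prod_iff hgm.aestronglyMeasurable]
    have hr : 0 < (3 - s.re) / 2 := by linarith
    constructor
    · refine (ae_restrict_iff' measurableSet_Ioi).2 (Eventually.of_forall fun x hx => ?_)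
      have hx : 0 < x := hx
      have hI : IntegrableOn (fun u : ℝ => u ^ ((3 - s.re) / 2 - 1) *
          Real.exp (-((π * x ^ 2) * u))) (Ioi 0) := by
        by_contra hcon
        have h1 := Real.integral_rpow_mul_exp_neg_mul_Ioi hr (show 0 < π * x ^ 2 by positivity)
        rw [integral_undef hcon] at h1
        have : 0 < (1 / (π * x ^ 2)) ^ ((3 - s.re) / 2) * Real.Gamma ((3 - s.re) / 2) := by
          have := Real.Gamma_pos_of_pos hr
          positivity
        linarith
      refine Integrable.mono' (hI.const_mul (x * |Real.sin (2 * π * x)|))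
        (hgm.comp (measurable_const.prodMk measurable_id)).aestronglyMeasurable ?_
      refine (ae_restrict_iff' measurableSet_Ioi).2 (Eventually.of_forall fun u hu => ?_)
      exact (hnorm x hx u hu).le
    · refine ((aux_int_s6 hs0 hs1).const_mul
        (π ^ (-((3 - s.re) / 2)) * Real.Gamma ((3 - s.re) / 2))).congr ?_
      refine (ae_restrict_iff' measurableSet_Ioi).2 (Eventually.of_forall fun x hx => ?_)
      have hx : 0 < x := hx
      simp only [Function.uncurry_apply_pair]
      rw [setIntegral_congr_fun measurableSet_Ioi (fun u hu => hnorm x hx u hu),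
        integral_const_mul, Real.integral_rpow_mul_exp_neg_mul_Ioi hr (by positivity)]
      have : (1 / (π * x ^ 2)) ^ ((3 - s.re) / 2) * x =
          π ^ (-((3 - s.re) / 2)) * x ^ (s.re - 2) := by
        rw [one_div, Real.inv_rpow (by positivity), ← Real.rpow_neg (by positivity),
          Real.mul_rpow Real.pi_pos.le (by positivity), ← Real.rpow_natCast, ← Real.rpow_mul hx.le,
          mul_assoc, ← Real.rpow_add_one hx.ne']
        congr 2
        push_cast
        ring
      linear_combination (-|Real.sin (2 * π * x)| * Real.Gamma ((3 - s.re) / 2)) * this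
  have hswap := integral_integral_swap hint
  rw [setIntegral_congr_fun measurableSet_Ioi (fun x hx => hinner x hx), integral_const_mul] at hswap
  rw [hswap]
  have hinner2 : ∀ u > (0 : ℝ), ∫ x in Ioi (0 : ℝ), g x u =
      1 / 2 * ((u : ℂ) ^ (-(s / 2) - 1) * cexp (-((π : ℂ) * ((u⁻¹ : ℝ) : ℂ)))) := by
    intro u hu
    have hu' : (u : ℂ) ≠ 0 := by exact_mod_cast hu.ne'
    have h1 : ∀ x : ℝ, g x u = (u : ℂ) ^ ((3 - s) / 2 - 1) *
        ((x * Real.sin (2 * π * x) * Real.exp (-(π * u) * x ^ 2) : ℝ) : ℂ) := by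
      intro x
      simp only [hg]
      rw [show -(((π * x ^ 2 : ℝ) : ℂ) * u) = ((-(π * u) * x ^ 2 : ℝ) : ℂ) by push_cast; ring,
        ← ofReal_exp]
      push_cast; ring
    simp only [h1]
    rw [integral_const_mul, integral_complex_ofReal, aux_gauss_sin hu]
    rw [show -(s / 2) - 1 = ((3 - s) / 2 - 1) + ((-(3 / 2) : ℝ) : ℂ) by push_cast; ring,
      cpow_add _ _ hu', ← ofReal_cpow hu.le,
      show -((π : ℂ) * ((u⁻¹ : ℝ) : ℂ)) = ((-(π / u) : ℝ) : ℂ) by push_cast; ring, ← ofReal_exp]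
    push_cast
    ring
  rw [setIntegral_congr_fun measurableSet_Ioi (fun u hu => hinner2 u hu), integral_const_mul]
  congr 1
  have hm := mellin_comp_inv (fun u : ℝ => cexp (-((π : ℂ) * (u : ℂ)))) (-(s / 2))
  simp only [mellin, smul_eq_mul, neg_neg] at hm
  rw [hm, Complex.integral_cpow_mul_exp_neg_mul_Ioi (by simpa using hs0) Real.pi_pos, neg_div,
    one_div, ← ofReal_inv, ofReal_inv, cpow_neg, inv_cpow]
  rw [arg_ofReal_of_nonneg Real.pi_pos.le]
  exact Real.pi_pos.ne

lemma aux_parts {s : ℂ} (hs0 : 0 < s.re) (hs1 : s.re < 1) {T : ℝ} (hT : 0 ≤ T) :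
    ∫ x in (0 : ℝ)..T, (Real.cos (2 * π * x) : ℂ) * (x : ℂ) ^ (s - 1) =
      (1 - s) / (2 * π) * (∫ x in (0 : ℝ)..T, (Real.sin (2 * π * x) : ℂ) * (x : ℂ) ^ (s - 2))
      + 1 / (2 * π) * ((Real.sin (2 * π * T) : ℂ) * (T : ℂ) ^ (s - 1)) := by
  have hp' : (π : ℂ) ≠ 0 := by exact_mod_cast Real.pi_ne_zero
  have hsne : s - 1 ≠ 0 := by
    intro h
    have := congrArg re h
    simp at this
    linarith
  have hi1 : IntervalIntegrable (fun x : ℝ => (Real.cos (2 * π * x) : ℂ) * (x : ℂ) ^ (s - 1))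
      volume 0 T :=
    (intervalIntegral.intervalIntegrable_cpow' (by simpa using hs0)).continuousOn_mul
      (by fun_prop)
  have hi2 : IntervalIntegrable (fun x : ℝ => (Real.sin (2 * π * x) : ℂ) * (x : ℂ) ^ (s - 2))
      volume 0 T :=
    (intervalIntegrable_iff_integrableOn_Ioc_of_le hT).2
      ((aux_int_c hs0 hs1).mono_set Ioc_subset_Ioi_self)
  have hd : ∀ x : ℝ, x ≠ 0 → HasDerivAt
      (fun x : ℝ => (Real.sin (2 * π * x) : ℂ) * (x : ℂ) ^ (s - 1))
      (2 * π * ((Real.cos (2 * π * x) : ℂ) * (x : ℂ) ^ (s - 1)) +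
        (s - 1) * ((Real.sin (2 * π * x) : ℂ) * (x : ℂ) ^ (s - 2))) x := by
    intro x hx
    have h1 : HasDerivAt (fun x => Real.sin (2 * π * x)) (Real.cos (2 * π * x) * (2 * π * 1)) x :=
      ((hasDerivAt_id x).const_mul (2 * π)).sin
    refine (h1.ofReal_comp.mul (hasDerivAt_ofReal_cpow_const hx hsne)).congr_deriv ?_
    rw [show s - 1 - 1 = s - 2 by ring]
    push_cast
    ring
  have hc : ContinuousOn (fun x : ℝ => (Real.sin (2 * π * x) : ℂ) * (x : ℂ) ^ (s - 1))
      (Icc 0 T) := by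
    intro x hx
    rcases eq_or_lt_of_le hx.1 with h | h
    · subst h
      have hlim : Tendsto (fun x : ℝ => 2 * π * x ^ s.re) (nhdsWithin 0 (Icc 0 T)) (nhds 0) := by
        have : ContinuousAt (fun x : ℝ => 2 * π * x ^ s.re) 0 :=
          continuousAt_const.mul (Real.continuousAt_rpow_const _ _ (Or.inr hs0.le))
        have := this.tendsto
        simp only [Real.zero_rpow hs0.ne', mul_zero] at this
        exact this.mono_left nhdsWithin_le_nhds
      rw [ContinuousWithinAt]
      simp only [mul_zero, Real.sin_zero, ofReal_zero, zero_mul]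
      refine squeeze_zero_norm' ?_ hlim
      filter_upwards [self_mem_nhdsWithin] with x hx
      rcases eq_or_lt_of_le hx.1 with h | h
      · subst h; simp [Real.zero_rpow hs0.ne']
      · rw [norm_mul, norm_cpow_eq_rpow_re_of_pos h, norm_real, Real.norm_eq_abs, sub_re, one_re]
        have : |Real.sin (2 * π * x)| ≤ 2 * π * x := by
          refine Real.abs_sin_le_abs.trans ?_
          rw [abs_of_pos (by positivity)]
        calc _ ≤ 2 * π * x * x ^ (s.re - 1) := by gcongr
          _ = 2 * π * x ^ s.re := by
            conv_rhs => rw [show s.re = s.re - 1 + 1 by ring, Real.rpow_add_one h.ne']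
            ring
    · exact (hd x h.ne').continuousAt.continuousWithinAt
  have key := intervalIntegral.integral_eq_sub_of_hasDerivAt_of_le hT hc
    (fun x hx => hd x hx.1.ne') ((hi1.const_mul _).add (hi2.const_mul _))
  rw [intervalIntegral.integral_add (hi1.const_mul _) (hi2.const_mul _),
    intervalIntegral.integral_const_mul, intervalIntegral.integral_const_mul] at key
  simp only [mul_zero, Real.sin_zero, ofReal_zero, zero_mul, sub_zero] at key
  rw [← key]
  field_simp
  ring

lemma aux_even {s : ℂ} (hs0 : 0 < s.re) {T : ℝ} (hT : 0 ≤ T) :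
    ∫ x in (-T)..T, (Real.cos (2 * π * x) : ℂ) * ((|x| : ℝ) : ℂ) ^ (s - 1) =
      2 * ∫ x in (0 : ℝ)..T, (Real.cos (2 * π * x) : ℂ) * (x : ℂ) ^ (s - 1) := by
  set f : ℝ → ℂ := fun x => (Real.cos (2 * π * x) : ℂ) * ((|x| : ℝ) : ℂ) ^ (s - 1) with hf
  have hev : ∀ x, f x = f (-x) := by
    intro x; simp only [hf, abs_neg, mul_neg, Real.cos_neg]
  have heq : EqOn f (fun x : ℝ => (Real.cos (2 * π * x) : ℂ) * (x : ℂ) ^ (s - 1)) (uIcc 0 T) := by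
    intro x hx
    rw [uIcc_of_le hT] at hx
    simp only [hf, abs_of_nonneg hx.1]
  have hi1 : IntervalIntegrable (fun x : ℝ => (Real.cos (2 * π * x) : ℂ) * (x : ℂ) ^ (s - 1))
      volume 0 T :=
    (intervalIntegral.intervalIntegrable_cpow' (by simpa using hs0)).continuousOn_mul
      (by fun_prop)
  have hi : IntervalIntegrable f volume 0 T :=
    hi1.congr (heq.symm.mono uIoc_subset_uIcc)
  have hneg : ∫ x in (-T)..0, f x = ∫ x in (0 : ℝ)..T, f x := by
    have := intervalIntegral.integral_comp_neg (a := 0) (b := T) f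
    rw [neg_zero] at this
    rw [← this]
    exact intervalIntegral.integral_congr fun x _ => (hev x).symm
  have hi' : IntervalIntegrable f volume (-T) 0 := by
    refine intervalIntegrable_of_even (a := -T) (b := 0) hev ?_
    intro x hx
    have hi2 : IntervalIntegrable (fun x : ℝ => (Real.cos (2 * π * x) : ℂ) * (x : ℂ) ^ (s - 1))
        volume 0 x :=
      (intervalIntegral.intervalIntegrable_cpow' (by simpa using hs0)).continuousOn_mul
        (by fun_prop)
    refine hi2.congr fun y hy => ?_
    rw [uIoc_of_le hx.le] at hy
    simp only [hf, abs_of_nonneg hy.1.le]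
  rw [← intervalIntegral.integral_add_adjacent_intervals hi' hi, hneg,
    intervalIntegral.integral_congr heq]
  ring

/-- For `0 < Re s < 1`, the improper integral `∫_ℝ cos(2πx)|x|^{s-1} dx`, interpreted as
`lim_{T→∞} ∫_{-T}^{T} cos(2πx)|x|^{s-1} dx`, exists and equals
`π^{-s/2} Γ(s/2) / (π^{(s-1)/2} Γ((1-s)/2))`. -/
theorem improper_integral_cos_abs_rpow (s : ℂ) (hs0 : 0 < s.re) (hs1 : s.re < 1) :
    Tendsto (fun T : ℝ =>
        ∫ x in (-T)..T, (Real.cos (2 * π * x) : ℂ) * (|x| : ℝ) ^ (s - 1))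
      atTop
      (nhds ((Real.pi : ℂ) ^ (-s / 2) * Complex.Gamma (s / 2)
        / ((Real.pi : ℂ) ^ ((s - 1) / 2) * Complex.Gamma ((1 - s) / 2)))) := by
  have hp' : (π : ℂ) ≠ 0 := by exact_mod_cast Real.pi_ne_zero
  have hsne : (1 - s) / 2 ≠ 0 := by
    intro h
    have := congrArg re h
    simp at this
    linarith
  have hG : Complex.Gamma ((1 - s) / 2) ≠ 0 :=
    Complex.Gamma_ne_zero_of_re_pos (by simp; linarith)
  have hlim0 : Tendsto (fun T : ℝ => (Real.sin (2 * π * T) : ℂ) * (T : ℂ) ^ (s - 1))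
      atTop (nhds 0) := by
    have h0 := tendsto_rpow_neg_atTop (show 0 < 1 - s.re by linarith)
    refine squeeze_zero_norm' ?_ h0
    filter_upwards [eventually_gt_atTop 0] with x hx
    rw [norm_mul, norm_cpow_eq_rpow_re_of_pos hx, norm_real, Real.norm_eq_abs, sub_re, one_re,
      neg_sub]
    exact mul_le_of_le_one_left (by positivity) (Real.abs_sin_le_one _)
  have hJ := intervalIntegral_tendsto_integral_Ioi 0 (aux_int_c hs0 hs1) tendsto_id
  have hall := ((hJ.const_mul ((1 - s) / (2 * π))).add
    (hlim0.const_mul (1 / (2 * π : ℂ)))).const_mul 2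
  have hval := aux_J hs0 hs1
  rw [show (3 - s) / 2 = (1 - s) / 2 + 1 by ring, Complex.Gamma_add_one _ hsne,
    show -((1 - s) / 2 + 1) = (s - 1) / 2 - 1 by ring, cpow_sub _ _ hp', cpow_one] at hval
  have hpc : (π : ℂ) ^ ((s - 1) / 2) ≠ 0 := by simp [cpow_eq_zero_iff, hp']
  refine (hall.congr' ?_).trans (le_of_eq ?_)
  · filter_upwards [eventually_ge_atTop 0] with T hT
    rw [aux_even hs0 hT, aux_parts hs0 hs1 hT]
    rfl
  · congr 1
    rw [eq_div_iff (mul_ne_zero hpc hG)]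
    generalize (∫ x in Ioi (0 : ℝ), (Real.sin (2 * π * x) : ℂ) * (x : ℂ) ^ (s - 2)) = J at *
    field_simp at hval ⊢
    linear_combination hval
end

section
/- For every positive integer n, r₂(n) = 4·#{d ∈ ℕ : d | n, d ≡ 1 (mod 4)} − 4·#{d ∈ ℕ : d | n, d ≡ −1 (mod 4)}, where r₂(n) = #{(x, y) ∈ ℤ² : x² + y² = n}. -/
open Finset

/-- `r₂(n)` is the number of representations of `n` as an ordered sum of two squares
of integers. -/
noncomputable def r2 (n : ℕ) : ℕ := Set.ncard {p : ℤ × ℤ | p.1 ^ 2 + p.2 ^ 2 = (n : ℤ)}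

/-- The lattice points on the circle `x² + y² = n`. -/
def circlePts (n : ℤ) : Set (ℤ × ℤ) := {p : ℤ × ℤ | p.1 ^ 2 + p.2 ^ 2 = n}

/-- Multiplication by the Gaussian integer `a + b i`. -/
def gmul (a b : ℤ) (z : ℤ × ℤ) : ℤ × ℤ := (a * z.1 - b * z.2, a * z.2 + b * z.1)

lemma circlePts_finite (n : ℤ) : (circlePts n).Finite := by
  apply Set.Finite.subset (Set.finite_Icc ((-n, -n) : ℤ × ℤ) (n, n))
  rintro ⟨x, y⟩ h
  simp only [circlePts, Set.mem_ofPred_eq] at h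
  simp only [Set.mem_Icc, Prod.mk_le_mk]
  have hx : |x| ≤ x ^ 2 := by rw [← sq_abs]; nlinarith [abs_nonneg x, Int.le_self_sq |x|]
  have hy : |y| ≤ y ^ 2 := by rw [← sq_abs]; nlinarith [abs_nonneg y, Int.le_self_sq |y|]
  have h1 := abs_le.mp (show |x| ≤ n by nlinarith [sq_nonneg y])
  have h2 := abs_le.mp (show |y| ≤ n by nlinarith [sq_nonneg x])
  exact ⟨⟨h1.1, h2.1⟩, h1.2, h2.2⟩

lemma gmul_injective (a b : ℤ) (h : a ^ 2 + b ^ 2 ≠ 0) : Function.Injective (gmul a b) := by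
  rintro ⟨x, y⟩ ⟨u, v⟩ huv
  simp only [gmul, Prod.mk.injEq] at huv
  obtain ⟨h1, h2⟩ := huv
  ext
  · apply mul_left_cancel₀ h
    simp only
    linear_combination a * h1 + b * h2
  · apply mul_left_cancel₀ h
    simp only
    linear_combination a * h2 - b * h1

lemma gmul_mem (a b n : ℤ) (z : ℤ × ℤ) (hz : z ∈ circlePts n) :
    gmul a b z ∈ circlePts ((a ^ 2 + b ^ 2) * n) := by
  simp only [circlePts, Set.mem_ofPred_eq, gmul] at *
  rw [← hz]; ring

lemma mem_image_gmul {a b p n x y : ℤ} (hp : Prime p) (hab : a ^ 2 + b ^ 2 = p)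
    (h : x ^ 2 + y ^ 2 = p * n) (hd : p ∣ a * x + b * y) :
    (x, y) ∈ gmul a b '' circlePts n := by
  have h2 : p ∣ a * y - b * x := by
    apply hp.dvd_of_dvd_pow (n := 2)
    have : (a * y - b * x) ^ 2 = p * (p * n) - (a * x + b * y) ^ 2 := by
      rw [← h, ← hab]; ring
    rw [this]
    exact dvd_sub (dvd_mul_right _ _) (dvd_pow hd two_ne_zero)
  obtain ⟨u, hu⟩ := hd
  obtain ⟨v, hv⟩ := h2
  refine ⟨(u, v), ?_, ?_⟩
  · simp only [circlePts, Set.mem_ofPred_eq]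
    apply mul_left_cancel₀ (mul_ne_zero hp.ne_zero hp.ne_zero)
    calc p * p * (u ^ 2 + v ^ 2) = (p * u) ^ 2 + (p * v) ^ 2 := by ring
      _ = (a ^ 2 + b ^ 2) * (x ^ 2 + y ^ 2) := by rw [← hu, ← hv]; ring
      _ = p * p * n := by rw [h, hab]; ring
  · simp only [gmul, Prod.mk.injEq]
    constructor
    · apply mul_left_cancel₀ hp.ne_zero
      calc p * (a * u - b * v) = a * (p * u) - b * (p * v) := by ring
        _ = (a ^ 2 + b ^ 2) * x := by rw [← hu, ← hv]; ring
        _ = p * x := by rw [hab]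
    · apply mul_left_cancel₀ hp.ne_zero
      calc p * (a * v + b * u) = a * (p * v) + b * (p * u) := by ring
        _ = (a ^ 2 + b ^ 2) * y := by rw [← hu, ← hv]; ring
        _ = p * y := by rw [hab]

/-- The common value `r₂(n / p)`, read as `0` when `p ∤ n`, counts multiples of `p`. -/
lemma ncard_multiples {p : ℤ} (hp : Prime p) (n : ℤ) :
    (gmul p 0 '' {w | gmul p 0 w ∈ circlePts (p * n)}).ncard
      = if p ∣ n then (circlePts (n / p)).ncard else 0 := by
  rw [Set.ncard_image_of_injective _ (gmul_injective p 0 (by simpa using hp.ne_zero))]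
  have key : ∀ w : ℤ × ℤ, gmul p 0 w ∈ circlePts (p * n) ↔ p * (w.1 ^ 2 + w.2 ^ 2) = n := by
    intro w
    simp only [circlePts, Set.mem_ofPred_eq, gmul]
    constructor
    · intro h
      apply mul_left_cancel₀ hp.ne_zero
      linear_combination h
    · intro h
      linear_combination p * h
  simp only [key]
  split_ifs with hd
  · obtain ⟨m, rfl⟩ := hd
    rw [Int.mul_ediv_cancel_left _ hp.ne_zero]
    congr 1
    ext w
    simp only [circlePts, Set.mem_ofPred_eq]
    exact ⟨fun h => mul_left_cancel₀ hp.ne_zero h, fun h => by rw [h]⟩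
  · convert Set.ncard_empty (ℤ × ℤ)
    ext w
    simp only [Set.mem_ofPred_eq, Set.mem_empty_iff_false, iff_false]
    rintro rfl
    exact hd (dvd_mul_right _ _)

lemma mem_multiples {p n x y : ℤ} (h : x ^ 2 + y ^ 2 = p * n) (hx : p ∣ x) (hy : p ∣ y) :
    (x, y) ∈ gmul p 0 '' {w | gmul p 0 w ∈ circlePts (p * n)} := by
  obtain ⟨u, rfl⟩ := hx
  obtain ⟨v, rfl⟩ := hy
  refine ⟨(u, v), ?_, ?_⟩
  · simpa [circlePts, gmul] using h
  · simp [gmul]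

lemma rec_two (n : ℤ) : (circlePts (2 * n)).ncard = (circlePts n).ncard := by
  rw [← Set.ncard_image_of_injective (circlePts n) (gmul_injective 1 1 (by norm_num))]
  congr 1
  ext ⟨x, y⟩
  constructor
  · intro h
    refine mem_image_gmul Int.prime_two (by norm_num) h ?_
    simp only [circlePts, Set.mem_ofPred_eq] at h
    have : Even (x ^ 2 + y ^ 2) := by rw [h]; exact even_two_mul n
    rw [← even_iff_two_dvd]
    simpa [Int.even_add, Int.even_pow] using this
  · rintro ⟨w, hw, hw'⟩
    rw [← hw']
    exact gmul_mem 1 1 n w hw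

lemma rec_three {p : ℕ} (hp : p.Prime) (h3 : p % 4 = 3) (n : ℤ) :
    (circlePts (p * n)).ncard
      = if (p : ℤ) ∣ n then (circlePts (n / p)).ncard else 0 := by
  have := Fact.mk hp
  rw [← ncard_multiples (Nat.prime_iff_prime_int.mp hp)]
  congr 1
  ext ⟨x, y⟩
  constructor
  · intro h
    simp only [circlePts, Set.mem_ofPred_eq] at h
    have hz : (x : ZMod p) ^ 2 + (y : ZMod p) ^ 2 = 0 := by
      have := congrArg (Int.cast : ℤ → ZMod p) h
      push_cast at this
      simpa using this
    apply mem_multiples h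
    · rw [← ZMod.intCast_zmod_eq_zero_iff_dvd]
      by_contra hx
      exact ZMod.mod_four_ne_three_of_sq_eq_neg_sq' hx
        (show (y : ZMod p) ^ 2 = -(x : ZMod p) ^ 2 by linear_combination hz) h3
    · rw [← ZMod.intCast_zmod_eq_zero_iff_dvd]
      by_contra hx
      exact ZMod.mod_four_ne_three_of_sq_eq_neg_sq' hx
        (show (x : ZMod p) ^ 2 = -(y : ZMod p) ^ 2 by linear_combination hz) h3
  · rintro ⟨w, hw, hw'⟩
    rw [← hw']
    exact hw

lemma rec_one {p : ℕ} (hp : p.Prime) (h1 : p % 4 = 1) (n : ℤ) :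
    (circlePts (p * n)).ncard + (if (p : ℤ) ∣ n then (circlePts (n / p)).ncard else 0)
      = 2 * (circlePts n).ncard := by
  have := Fact.mk hp
  have hP := Nat.prime_iff_prime_int.mp hp
  obtain ⟨a, b, hab⟩ : ∃ a b : ℤ, a ^ 2 + b ^ 2 = p := by
    obtain ⟨a, b, h⟩ := Nat.Prime.sq_add_sq (p := p) (by omega)
    exact ⟨a, b, by exact_mod_cast h⟩
  have hab' : a ^ 2 + (-b) ^ 2 = p := by rw [← hab]; ring
  have hp0 : (p : ℤ) ≠ 0 := hP.ne_zero
  have hpos : (0 : ℤ) < p := by exact_mod_cast hp.pos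
  have small : ∀ c d : ℤ, c ^ 2 + d ^ 2 = p → ¬ (p : ℤ) ∣ c := by
    rintro c d hcd ⟨k, rfl⟩
    have hd : (p : ℤ) ∣ d := by
      apply hP.dvd_of_dvd_pow (n := 2)
      exact ⟨1 - p * k ^ 2, by linear_combination hcd⟩
    obtain ⟨l, rfl⟩ := hd
    apply hP.not_isUnit
    apply isUnit_of_dvd_one
    refine ⟨k ^ 2 + l ^ 2, ?_⟩
    apply mul_left_cancel₀ hp0
    linear_combination -hcd
  have h2 : ¬ (p : ℤ) ∣ 2 := by
    intro h
    have : p ∣ 2 := by exact_mod_cast h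
    have := (Nat.prime_dvd_prime_iff_eq hp Nat.prime_two).mp this
    omega
  have hU : gmul a b '' circlePts n ∪ gmul a (-b) '' circlePts n = circlePts (p * n) := by
    ext ⟨x, y⟩
    constructor
    · rintro (⟨w, hw, hw'⟩ | ⟨w, hw, hw'⟩) <;> rw [← hw']
      · rw [← hab]; exact gmul_mem _ _ _ _ hw
      · rw [← hab']; exact gmul_mem _ _ _ _ hw
    · intro h
      simp only [circlePts, Set.mem_ofPred_eq] at h
      have : (p : ℤ) ∣ (a * x + b * y) * (a * x + (-b) * y) :=
        ⟨a ^ 2 * n - y ^ 2, by linear_combination a ^ 2 * h - y ^ 2 * hab⟩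
      rcases hP.dvd_or_dvd this with h' | h'
      · exact Or.inl (mem_image_gmul hP hab h h')
      · exact Or.inr (mem_image_gmul hP hab' h h')
  have hI : gmul a b '' circlePts n ∩ gmul a (-b) '' circlePts n
      = gmul p 0 '' {w | gmul p 0 w ∈ circlePts (p * n)} := by
    ext ⟨x, y⟩
    constructor
    · intro h
      have hT : (x, y) ∈ circlePts (p * n) := hU ▸ Or.inl h.1
      obtain ⟨⟨u, hu, hu'⟩, ⟨v, hv, hv'⟩⟩ := h
      simp only [gmul, Prod.mk.injEq] at hu' hv'
      have e1 : (p : ℤ) ∣ 2 * (a * x) :=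
        ⟨u.1 + v.1, by
          linear_combination - a * hu'.1 - a * hv'.1 - b * hu'.2 + b * hv'.2 + (u.1 + v.1) * hab⟩
      have e2 : (p : ℤ) ∣ 2 * (a * y) :=
        ⟨u.2 + v.2, by
          linear_combination - a * hu'.2 - a * hv'.2 + b * hu'.1 - b * hv'.1 + (u.2 + v.2) * hab⟩
      have ha := small a b hab
      exact mem_multiples hT
        (((hP.dvd_or_dvd e1).resolve_left h2 |> hP.dvd_or_dvd).resolve_left ha)
        (((hP.dvd_or_dvd e2).resolve_left h2 |> hP.dvd_or_dvd).resolve_left ha)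
    · rintro ⟨⟨u, v⟩, hw, hw'⟩
      rw [← hw']
      simp only [gmul, Set.mem_ofPred_eq] at hw ⊢
      have hw2 : (p * u - 0 * v) ^ 2 + (p * v + 0 * u) ^ 2 = p * n := hw
      exact ⟨mem_image_gmul hP hab hw2 ⟨a * u + b * v, by ring⟩,
        mem_image_gmul hP hab' hw2 ⟨a * u + (-b) * v, by ring⟩⟩
  have := Set.ncard_union_add_ncard_inter (gmul a b '' circlePts n) (gmul a (-b) '' circlePts n)
    ((circlePts_finite n).image _) ((circlePts_finite n).image _)
  rw [hU, hI, ncard_multiples hP,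
    Set.ncard_image_of_injective _ (gmul_injective a b (by rw [hab]; exact hp0)),
    Set.ncard_image_of_injective _ (gmul_injective a (-b) (by rw [hab']; exact hp0))] at this
  omega

/-- The divisor sum of the nontrivial character modulo 4. -/
def chiSum (n : ℕ) : ℤ := ∑ d ∈ n.divisors, ZMod.χ₄ (d : ZMod 4)

lemma chiSum_rec {p : ℕ} (hp : p.Prime) {n : ℕ} (hn : 0 < n) :
    chiSum (p * n) + ZMod.χ₄ (p : ZMod 4) * (if p ∣ n then chiSum (n / p) else 0)
      = (1 + ZMod.χ₄ (p : ZMod 4)) * chiSum n := by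
  have himg : ∀ s : Finset ℕ, ∑ d ∈ s.image (fun e => p * e), ZMod.χ₄ (d : ZMod 4)
      = ZMod.χ₄ (p : ZMod 4) * ∑ d ∈ s, ZMod.χ₄ (d : ZMod 4) := by
    intro s
    rw [Finset.sum_image (fun x _ y _ h => Nat.eq_of_mul_eq_mul_left hp.pos h), Finset.mul_sum]
    refine Finset.sum_congr rfl fun d _ => ?_
    push_cast
    rw [map_mul]
  have hU : (p * n).divisors = n.divisors ∪ n.divisors.image (fun e => p * e) := by
    ext d
    simp only [Nat.mem_divisors, Finset.mem_union, Finset.mem_image]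
    constructor
    · rintro ⟨h, -⟩
      by_cases hd : p ∣ d
      · obtain ⟨e, rfl⟩ := hd
        exact Or.inr ⟨e, ⟨Nat.dvd_of_mul_dvd_mul_left hp.pos h, hn.ne'⟩, rfl⟩
      · exact Or.inl ⟨((Nat.Prime.coprime_iff_not_dvd hp).mpr hd).symm.dvd_of_dvd_mul_left h, hn.ne'⟩
    · have h0 : p * n ≠ 0 := mul_ne_zero hp.ne_zero hn.ne'
      rintro (⟨h, -⟩ | ⟨e, ⟨h, -⟩, rfl⟩)
      · exact ⟨h.mul_left p, h0⟩
      · exact ⟨mul_dvd_mul_left p h, h0⟩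
  have hI : ∑ d ∈ n.divisors ∩ n.divisors.image (fun e => p * e), ZMod.χ₄ (d : ZMod 4)
      = ZMod.χ₄ (p : ZMod 4) * (if p ∣ n then chiSum (n / p) else 0) := by
    split_ifs with hd
    · obtain ⟨m, rfl⟩ := hd
      rw [Nat.mul_div_cancel_left _ hp.pos, chiSum, ← himg]
      congr 1
      ext d
      simp only [Nat.mem_divisors, Finset.mem_inter, Finset.mem_image]
      constructor
      · rintro ⟨⟨h, -⟩, e, -, rfl⟩
        exact ⟨e, ⟨Nat.dvd_of_mul_dvd_mul_left hp.pos h, right_ne_zero_of_mul hn.ne'⟩, rfl⟩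
      · rintro ⟨e, ⟨h, -⟩, rfl⟩
        exact ⟨⟨mul_dvd_mul_left p h, hn.ne'⟩, e, ⟨h.mul_left p, hn.ne'⟩, rfl⟩
    · rw [mul_zero]
      apply Finset.sum_eq_zero
      intro d h
      simp only [Nat.mem_divisors, Finset.mem_inter, Finset.mem_image] at h
      obtain ⟨⟨h, -⟩, e, -, rfl⟩ := h
      exact absurd ((dvd_mul_right p e).trans h) hd
  have := Finset.sum_union_inter (s₁ := n.divisors) (s₂ := n.divisors.image (fun e => p * e))
    (f := fun d : ℕ => ZMod.χ₄ (d : ZMod 4))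
  rw [← hU, hI, himg] at this
  simp only [chiSum] at *
  linear_combination this

lemma circlePts_one : (circlePts 1).ncard = 4 := by
  have : circlePts 1 = (({(1, 0), (-1, 0), (0, 1), (0, -1)} : Finset (ℤ × ℤ)) : Set (ℤ × ℤ)) := by
    ext ⟨x, y⟩
    simp only [circlePts, Set.mem_ofPred_eq, Finset.coe_insert, Finset.coe_singleton,
      Set.mem_insert_iff, Set.mem_singleton_iff, Prod.mk.injEq]
    constructor
    · intro h
      have hx1 : x ≤ 1 := by nlinarith [sq_nonneg y]
      have hx2 : -1 ≤ x := by nlinarith [sq_nonneg y]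
      have hy1 : y ≤ 1 := by nlinarith [sq_nonneg x]
      have hy2 : -1 ≤ y := by nlinarith [sq_nonneg x]
      interval_cases x <;> interval_cases y <;> simp_all
    · rintro (⟨rfl, rfl⟩ | ⟨rfl, rfl⟩ | ⟨rfl, rfl⟩ | ⟨rfl, rfl⟩) <;> norm_num
  rw [this, Set.ncard_coe_finset]
  decide

lemma ncard_eq_chiSum (n : ℕ) (hn : 0 < n) : ((circlePts n).ncard : ℤ) = 4 * chiSum n := by
  induction n using Nat.strong_induction_on with
  | _ n ih =>
    by_cases h1 : n = 1
    · subst h1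
      simp [circlePts_one, chiSum]
    obtain ⟨p, hp, m, rfl⟩ := Nat.exists_prime_and_dvd h1
    have hm : 0 < m := Nat.pos_of_mul_pos_left hn |> fun _ => Nat.pos_of_ne_zero (by rintro rfl; simp at hn)
    have hlt : m < p * m := by nlinarith [hp.two_le]
    have ihm := ih m hlt hm
    have hq : (((if (p : ℤ) ∣ (m : ℤ) then (circlePts ((m : ℤ) / p)).ncard else 0 : ℕ)) : ℤ)
        = 4 * (if p ∣ m then chiSum (m / p) else 0) := by
      by_cases hd : p ∣ m
      · have hd' : (p : ℤ) ∣ m := by exact_mod_cast hd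
        rw [if_pos hd, if_pos hd', ← ih (m / p) ((Nat.div_le_self _ _).trans_lt hlt)
          (Nat.div_pos (Nat.le_of_dvd hm hd) hp.pos)]
        push_cast
        rfl
      · have hd' : ¬ (p : ℤ) ∣ m := by exact_mod_cast hd
        rw [if_neg hd, if_neg hd']; simp
    have hr := chiSum_rec hp hm
    push_cast
    rcases hp.eq_two_or_odd with h2 | hodd
    · subst h2
      have hc : ZMod.χ₄ ((2 : ℕ) : ZMod 4) = 0 := by decide
      rw [hc] at hr
      have := rec_two (m : ℤ)
      push_cast
      rw [this, ihm]
      linear_combination -4 * hr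
    · have h4 : p % 4 = 1 ∨ p % 4 = 3 := by omega
      rcases h4 with h4 | h4
      · rw [ZMod.χ₄_nat_one_mod_four h4] at hr
        have := rec_one hp h4 (m : ℤ)
        zify at this
        push_cast at hq
        linear_combination this - hq + 2 * ihm - 4 * hr
      · rw [ZMod.χ₄_nat_three_mod_four h4] at hr
        rw [rec_three hp h4 (m : ℤ), hq]
        linear_combination -4 * hr

/-- For every positive integer `n`,
`r₂(n) = 4·#{d | n, d ≡ 1 mod 4} - 4·#{d | n, d ≡ 3 mod 4}`. -/
theorem r2_eq_four_mul_divisor_count_difference (n : ℕ) (hn : 0 < n) :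
    (r2 n : ℤ)
      = 4 * ((n.divisors.filter (fun d => d % 4 = 1)).card : ℤ)
        - 4 * ((n.divisors.filter (fun d => d % 4 = 3)).card : ℤ) := by
  have h : (r2 n : ℤ) = 4 * chiSum n := ncard_eq_chiSum n hn
  rw [h, ← mul_sub, chiSum, Finset.card_filter, Finset.card_filter]
  push_cast
  rw [← Finset.sum_sub_distrib]
  congr 1
  refine Finset.sum_congr rfl fun d _ => ?_
  rw [ZMod.χ₄_nat_eq_if_mod_four]
  split_ifs <;> first | omega | rfl
end

section
/- For all s ∈ ℂ with Re s > 1, (1/4) ∑_{n=1}^∞ r₂(n) n^{−s} = ζ(s) · L(s, χ₄), where r₂(n) = #{(x, y) ∈ ℤ² : x² + y² = n}, ζ is the Riemann zeta function, and L(s, χ₄) = ∑_{k=0}^∞ (−1)^k (2k+1)^{−s}; all series converge absolutely for Re s > 1. -/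
open Real Complex Finset

/-- Gaussian integers of norm `n`. -/
def gaussS (n : ℕ) : Set GaussianInt := {z | z.norm = (n : ℤ)}

lemma gauss_norm (z : GaussianInt) : z.norm = z.re ^ 2 + z.im ^ 2 := by
  rw [Zsqrtd.norm_def]; ring

lemma gaussS_finite (n : ℕ) : (gaussS n).Finite := by
  have h : (gaussS n) ⊆ (fun p : ℤ × ℤ => (⟨p.1, p.2⟩ : GaussianInt)) ''
      (Set.Icc (-(n : ℤ)) n ×ˢ Set.Icc (-(n : ℤ)) n) := by
    intro z hz
    have hz' : z.re ^ 2 + z.im ^ 2 = (n : ℤ) := by rw [← gauss_norm]; exact hz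
    refine ⟨(z.re, z.im), ?_, rfl⟩
    simp only [Set.mem_prod, Set.mem_Icc]
    refine ⟨⟨?_, ?_⟩, ?_, ?_⟩ <;> nlinarith [sq_nonneg z.re, sq_nonneg z.im, Int.le_self_sq z.re,
      Int.le_self_sq z.im, Int.le_self_sq (-z.re), Int.le_self_sq (-z.im)]
  exact (((Set.finite_Icc _ _).prod (Set.finite_Icc _ _)).image _).subset h

lemma r2_eq_ncard (n : ℕ) : r2 n = (gaussS n).ncard := by
  unfold r2
  have hinj : Function.Injective (fun p : ℤ × ℤ => (⟨p.1, p.2⟩ : GaussianInt)) := by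
    rintro ⟨a, b⟩ ⟨c, d⟩ h
    simpa [Zsqrtd.ext_iff] using h
  rw [← Set.ncard_image_of_injective _ hinj]
  congr 1
  ext z
  simp only [Set.mem_image, Set.mem_ofPred_eq, gaussS, gauss_norm]
  constructor
  · rintro ⟨p, hp, rfl⟩
    exact hp
  · intro h
    exact ⟨(z.re, z.im), h, rfl⟩

lemma r2_one : r2 1 = 4 := by
  have : {p : ℤ × ℤ | p.1 ^ 2 + p.2 ^ 2 = ((1 : ℕ) : ℤ)}
      = (({(1, 0), (-1, 0), (0, 1), (0, -1)} : Finset (ℤ × ℤ)) : Set (ℤ × ℤ)) := by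
    ext ⟨a, b⟩
    simp only [Set.mem_ofPred_eq, Finset.coe_insert, Finset.coe_singleton, Set.mem_insert_iff,
      Set.mem_singleton_iff, Prod.mk.injEq, Nat.cast_one]
    constructor
    · intro h
      have h1 : a ≤ 1 := by nlinarith
      have h2 : -1 ≤ a := by nlinarith
      have h3 : b ≤ 1 := by nlinarith
      have h4 : -1 ≤ b := by nlinarith
      interval_cases a <;> interval_cases b <;> simp_all
    · rintro (⟨rfl, rfl⟩ | ⟨rfl, rfl⟩ | ⟨rfl, rfl⟩ | ⟨rfl, rfl⟩) <;> norm_num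
  unfold r2
  rw [this, Set.ncard_coe_finset]
  decide

/-- Elements of norm `m` divisible by `a`. -/
lemma ncard_dvd (a : GaussianInt) (q n m : ℕ) (hq : q ≠ 0) (ha : a.norm = (q : ℤ))
    (hm : m = q * n) : ({z | a ∣ z} ∩ gaussS m).ncard = r2 n := by
  have ha0 : a ≠ 0 := by
    rintro rfl
    rw [Zsqrtd.norm_zero] at ha
    exact hq (by exact_mod_cast ha.symm)
  have hinj : Function.Injective (fun w : GaussianInt => a * w) := mul_right_injective₀ ha0
  rw [r2_eq_ncard, ← Set.ncard_image_of_injective (gaussS n) hinj]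
  congr 1
  have hq' : (q : ℤ) ≠ 0 := by exact_mod_cast hq
  ext z
  simp only [Set.mem_inter_iff, Set.mem_ofPred_eq, gaussS, Set.mem_image]
  constructor
  · rintro ⟨⟨w, rfl⟩, h⟩
    refine ⟨w, ?_, rfl⟩
    rw [Zsqrtd.norm_mul, ha, hm, Nat.cast_mul] at h
    exact mul_left_cancel₀ hq' h
  · rintro ⟨w, h, rfl⟩
    refine ⟨⟨w, rfl⟩, ?_⟩
    rw [Zsqrtd.norm_mul, ha, hm, h, Nat.cast_mul]

/-- `r₂(n / p)`, or zero if `p` does not divide `n`. -/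
noncomputable def r2q (p n : ℕ) : ℕ := if p ∣ n then r2 (n / p) else 0

lemma ncard_dvd_p (p n : ℕ) (hp : p.Prime) :
    ({z | (p : GaussianInt) ∣ z} ∩ gaussS (p * n)).ncard = r2q p n := by
  unfold r2q
  split_ifs with h
  · obtain ⟨k, rfl⟩ := h
    rw [Nat.mul_div_cancel_left _ hp.pos]
    exact ncard_dvd _ (p * p) k _ (by simp [hp.ne_zero]) (by simp) (by ring)
  · convert Set.ncard_empty GaussianInt
    ext z
    simp only [Set.mem_inter_iff, Set.mem_ofPred_eq, gaussS, Set.mem_empty_iff_false, iff_false]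
    rintro ⟨⟨w, rfl⟩, hw⟩
    apply h
    rw [Zsqrtd.norm_mul, Zsqrtd.norm_natCast, Nat.cast_mul, mul_assoc] at hw
    have hp' : (p : ℤ) ≠ 0 := by exact_mod_cast hp.ne_zero
    have := mul_left_cancel₀ hp' hw
    exact Int.natCast_dvd_natCast.mp ⟨_, this.symm⟩

lemma gauss_prime_of_norm (a : GaussianInt) (p : ℕ) (hp : p.Prime) (ha : a.norm = (p : ℤ)) :
    Prime a := by
  rw [← irreducible_iff_prime]
  constructor
  · intro h
    rw [← Zsqrtd.norm_eq_one_iff, ha, Int.natAbs_natCast] at h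
    exact hp.one_lt.ne' h
  · rintro x y rfl
    rw [← Zsqrtd.norm_eq_one_iff, ← Zsqrtd.norm_eq_one_iff]
    have : x.norm.natAbs * y.norm.natAbs = p := by
      rw [← Int.natAbs_mul, ← Zsqrtd.norm_mul, ha, Int.natAbs_natCast]
    rcases Nat.prime_mul_iff.mp (this ▸ hp) with h | h
    · exact Or.inr h.2
    · exact Or.inl h.2

lemma star_dvd_star_gauss {a b : GaussianInt} (h : a ∣ b) : star a ∣ star b := by
  obtain ⟨c, rfl⟩ := h
  exact ⟨star c, by rw [star_mul, mul_comm]⟩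

lemma dvd_or_star_dvd (a : GaussianInt) (p n : ℕ) (ha : a.norm = (p : ℤ)) (hp : Prime a)
    (z : GaussianInt) (hz : z ∈ gaussS (p * n)) : a ∣ z ∨ star a ∣ z := by
  have h1 : a ∣ z * star z := by
    rw [← Zsqrtd.norm_eq_mul_conj, show z.norm = _ from hz, Nat.cast_mul, ← ha, Int.cast_mul,
      Zsqrtd.norm_eq_mul_conj, mul_assoc]
    exact dvd_mul_right _ _
  rcases hp.dvd_or_dvd h1 with h | h
  · exact Or.inl h
  · right
    simpa using star_dvd_star_gauss h

lemma exists_gauss (p : ℕ) (hp : p.Prime) (h3 : p % 4 ≠ 3) :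
    ∃ a : GaussianInt, a.norm = (p : ℤ) := by
  have := Fact.mk hp
  obtain ⟨a, b, h⟩ := Nat.Prime.sq_add_sq h3
  exact ⟨⟨a, b⟩, by rw [gauss_norm]; show (a : ℤ) ^ 2 + (b : ℤ) ^ 2 = p; exact_mod_cast h⟩

lemma r2_rec_two (n : ℕ) : r2 (2 * n) = r2 n := by
  let a : GaussianInt := ⟨1, 1⟩
  have ha : a.norm = ((2 : ℕ) : ℤ) := by rw [gauss_norm]; norm_num [a]
  have hpa := gauss_prime_of_norm a 2 Nat.prime_two ha
  rw [← ncard_dvd a 2 n (2 * n) two_ne_zero ha rfl, r2_eq_ncard]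
  congr 1
  symm
  rw [Set.inter_eq_right]
  intro z hz
  rcases dvd_or_star_dvd a 2 n ha hpa z hz with h | h
  · exact h
  · refine dvd_trans ⟨⟨0, -1⟩, ?_⟩ h
    ext <;> simp [a]

lemma r2_rec_three (p n : ℕ) (hp : p.Prime) (h3 : p % 4 = 3) : r2 (p * n) = r2q p n := by
  have := Fact.mk hp
  have hpp := GaussianInt.prime_of_nat_prime_of_mod_four_eq_three p h3
  rw [← ncard_dvd_p p n hp, r2_eq_ncard]
  congr 1
  symm
  rw [Set.inter_eq_right]
  intro z hz
  have h1 : (p : GaussianInt) ∣ z * star z := by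
    rw [← Zsqrtd.norm_eq_mul_conj, show z.norm = _ from hz]
    push_cast
    exact dvd_mul_right _ _
  rcases hpp.dvd_or_dvd h1 with h | h
  · exact h
  · simpa using star_dvd_star_gauss h

lemma star_not_dvd (a : GaussianInt) (p : ℕ) (hp : p.Prime) (h1 : p % 4 = 1)
    (ha : a.norm = (p : ℤ)) : ¬ star a ∣ a := by
  intro h
  have h2 : star a ∣ ((2 * a.re : ℤ) : GaussianInt) := by
    have : ((2 * a.re : ℤ) : GaussianInt) = a + star a := by
      ext
      · simp; ring
      · simp
    rw [this]
    exact dvd_add h dvd_rfl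
  obtain ⟨c, hc⟩ := h2
  have h3 := congrArg Zsqrtd.norm hc
  rw [Zsqrtd.norm_intCast, Zsqrtd.norm_mul, Zsqrtd.norm_conj, ha] at h3
  have hpi : Prime (p : ℤ) := Nat.prime_iff_prime_int.mp hp
  have h4 : (p : ℤ) ∣ 2 * a.re := by
    rcases hpi.dvd_or_dvd ⟨_, h3⟩ with h | h <;> exact h
  have h5 : (p : ℤ) ∣ a.re := by
    rcases hpi.dvd_or_dvd h4 with h | h
    · have := Nat.le_of_dvd (by norm_num) (Int.natCast_dvd_natCast.mp h)
      interval_cases p <;> omega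
    · exact h
  obtain ⟨k, hk⟩ := h5
  rw [gauss_norm] at ha
  have h6 : (p : ℤ) ∣ a.im := by
    apply hpi.dvd_of_dvd_pow (n := 2)
    exact ⟨1 - p * k ^ 2, by rw [hk] at ha; linear_combination ha⟩
  obtain ⟨l, hl⟩ := h6
  rw [hk, hl] at ha
  have h7 : (p : ℤ) * (k ^ 2 + l ^ 2) = 1 := by
    apply mul_left_cancel₀ hpi.ne_zero
    linear_combination ha
  exact hpi.not_isUnit (IsUnit.of_mul_eq_one _ h7)

lemma r2_rec_one (p n : ℕ) (hp : p.Prime) (h1 : p % 4 = 1) :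
    r2 (p * n) + r2q p n = 2 * r2 n := by
  obtain ⟨a, ha⟩ := exists_gauss p hp (by omega)
  have hpa := gauss_prime_of_norm a p hp ha
  have ha' : (star a).norm = (p : ℤ) := by rw [Zsqrtd.norm_conj, ha]
  have hpa' := gauss_prime_of_norm (star a) p hp ha'
  have hA := ncard_dvd a p n (p * n) hp.ne_zero ha rfl
  have hB := ncard_dvd (star a) p n (p * n) hp.ne_zero ha' rfl
  have hpaa : (p : GaussianInt) = a * star a := by
    rw [← Zsqrtd.norm_eq_mul_conj, ha]; simp
  have hU := Set.ncard_union_add_ncard_inter ({z | a ∣ z} ∩ gaussS (p * n))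
    ({z | star a ∣ z} ∩ gaussS (p * n)) ((gaussS_finite _).inter_of_right _)
    ((gaussS_finite _).inter_of_right _)
  rw [hA, hB] at hU
  have e1 : ({z | a ∣ z} ∩ gaussS (p * n)) ∪ ({z | star a ∣ z} ∩ gaussS (p * n))
      = gaussS (p * n) := by
    ext z
    simp only [Set.mem_union, Set.mem_inter_iff, Set.mem_ofPred_eq]
    constructor
    · rintro (h | h) <;> exact h.2
    · intro h
      rcases dvd_or_star_dvd a p n ha hpa z h with h' | h'
      · exact Or.inl ⟨h', h⟩
      · exact Or.inr ⟨h', h⟩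
  have e2 : ({z | a ∣ z} ∩ gaussS (p * n)) ∩ ({z | star a ∣ z} ∩ gaussS (p * n))
      = {z | (p : GaussianInt) ∣ z} ∩ gaussS (p * n) := by
    ext z
    simp only [Set.mem_inter_iff, Set.mem_ofPred_eq]
    constructor
    · rintro ⟨⟨⟨w, rfl⟩, hz⟩, h, -⟩
      refine ⟨?_, hz⟩
      rw [hpaa]
      rcases hpa'.dvd_or_dvd h with h | h
      · exact absurd h (star_not_dvd a p hp h1 ha)
      · exact mul_dvd_mul_left a h
    · rintro ⟨h, hz⟩
      rw [hpaa] at h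
      exact ⟨⟨(dvd_mul_right _ _).trans h, hz⟩, (dvd_mul_left _ _).trans h, hz⟩
  rw [e1, e2, ncard_dvd_p p n hp, ← r2_eq_ncard] at hU
  omega

/-- The divisor sum of the character modulo four. -/
def gchi (n : ℕ) : ℤ := ∑ d ∈ n.divisors, ZMod.χ₄ (d : ZMod 4)

/-- `gchi (n / p)`, or zero if `p` does not divide `n`. -/
def gchiq (p n : ℕ) : ℤ := if p ∣ n then gchi (n / p) else 0

lemma sum_image_mul (p n : ℕ) (hp : p.Prime) :
    ∑ d ∈ n.divisors.image (p * ·), ZMod.χ₄ (d : ZMod 4) = ZMod.χ₄ (p : ZMod 4) * gchi n := by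
  rw [Finset.sum_image (fun a _ b _ h => Nat.eq_of_mul_eq_mul_left hp.pos h), gchi,
    Finset.mul_sum]
  refine Finset.sum_congr rfl fun d _ => ?_
  rw [Nat.cast_mul, map_mul]

lemma gchi_rec (p n : ℕ) (hp : p.Prime) (hn : n ≠ 0) :
    gchi (p * n) + ZMod.χ₄ (p : ZMod 4) * gchiq p n
      = gchi n + ZMod.χ₄ (p : ZMod 4) * gchi n := by
  have hU := Finset.sum_union_inter (s₁ := n.divisors) (s₂ := n.divisors.image (p * ·))
    (f := fun d : ℕ => ZMod.χ₄ (d : ZMod 4))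
  rw [sum_image_mul p n hp] at hU
  have e1 : n.divisors ∪ n.divisors.image (p * ·) = (p * n).divisors := by
    ext d
    simp only [Finset.mem_union, Finset.mem_image, Nat.mem_divisors]
    constructor
    · rintro (h | ⟨e, h, rfl⟩)
      · exact ⟨h.1.mul_left p, mul_ne_zero hp.ne_zero hn⟩
      · exact ⟨mul_dvd_mul_left p h.1, mul_ne_zero hp.ne_zero hn⟩
    · rintro ⟨h, -⟩
      by_cases hpd : p ∣ d
      · obtain ⟨e, rfl⟩ := hpd
        exact Or.inr ⟨e, ⟨Nat.dvd_of_mul_dvd_mul_left hp.pos h, hn⟩, rfl⟩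
      · exact Or.inl ⟨((hp.coprime_iff_not_dvd.mpr hpd).symm).dvd_of_dvd_mul_left h, hn⟩
  have e2 : ∑ d ∈ n.divisors ∩ n.divisors.image (p * ·), ZMod.χ₄ (d : ZMod 4)
      = ZMod.χ₄ (p : ZMod 4) * gchiq p n := by
    unfold gchiq
    split_ifs with h
    · obtain ⟨k, rfl⟩ := h
      rw [Nat.mul_div_cancel_left _ hp.pos, ← sum_image_mul p k hp]
      congr 1
      ext d
      simp only [Finset.mem_inter, Finset.mem_image, Nat.mem_divisors]
      constructor
      · rintro ⟨h, e, h', rfl⟩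
        exact ⟨e, ⟨Nat.dvd_of_mul_dvd_mul_left hp.pos h.1, right_ne_zero_of_mul hn⟩, rfl⟩
      · rintro ⟨e, h, rfl⟩
        exact ⟨⟨mul_dvd_mul_left p h.1, hn⟩, e, ⟨h.1.mul_left p, hn⟩, rfl⟩
    · rw [mul_zero]
      convert Finset.sum_empty
      ext d
      simp only [Finset.mem_inter, Finset.mem_image, Nat.mem_divisors, Finset.notMem_empty,
        iff_false]
      rintro ⟨h', e, -, rfl⟩
      exact h ((dvd_mul_right p e).trans h'.1)
  rw [e1, e2] at hU
  exact hU

lemma r2_eq_gchi (n : ℕ) (hn : n ≠ 0) : (r2 n : ℤ) = 4 * gchi n := by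
  induction n using Nat.strong_induction_on with
  | _ n ih =>
  by_cases h1 : n = 1
  · subst h1
    rw [r2_one]
    simp [gchi]
  have hp := Nat.minFac_prime h1
  obtain ⟨m, hm⟩ := Nat.minFac_dvd n
  generalize n.minFac = p at hp hm
  subst hm
  have hm0 : m ≠ 0 := right_ne_zero_of_mul hn
  have hlt : m < p * m := lt_mul_of_one_lt_left (Nat.pos_of_ne_zero hm0) hp.one_lt
  have ihm := ih m hlt hm0
  have ihq : (r2q p m : ℤ) = 4 * gchiq p m := by
    unfold r2q gchiq
    split_ifs with h
    · have hle := Nat.div_le_self m p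
      exact ih _ (by omega)
        (Nat.div_pos (Nat.le_of_dvd (Nat.pos_of_ne_zero hm0) h) hp.pos).ne'
    · simp
  have hg := gchi_rec p m hp hm0
  rcases hp.eq_two_or_odd with h2 | h2
  · subst h2
    rw [r2_rec_two, ihm]
    have : ZMod.χ₄ ((2 : ℕ) : ZMod 4) = 0 := by decide
    rw [this] at hg
    linarith
  · have : p % 4 = 1 ∨ p % 4 = 3 := by omega
    rcases this with h | h
    · have hr := r2_rec_one p m hp h
      rw [ZMod.χ₄_nat_one_mod_four h] at hg
      zify at hr
      linarith
    · have hr := r2_rec_three p m hp h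
      rw [ZMod.χ₄_nat_three_mod_four h] at hg
      zify at hr
      linarith

/-- The character modulo four as a complex sequence. -/
noncomputable def cchi (n : ℕ) : ℂ := ((ZMod.χ₄ (n : ZMod 4) : ℤ) : ℂ)

lemma cchi_odd (k : ℕ) : cchi (2 * k + 1) = (-1) ^ k := by
  unfold cchi
  rw [ZMod.χ₄_eq_neg_one_pow (by omega), show (2 * k + 1) / 2 = k by omega]
  simp

lemma cchi_even (k : ℕ) : cchi (2 * k) = 0 := by
  unfold cchi
  rw [ZMod.χ₄_nat_eq_if_mod_four, if_pos (by omega)]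
  simp

lemma cchi_norm_le (n : ℕ) : ‖cchi n‖ ≤ 1 := by
  rcases Nat.even_or_odd' n with ⟨k, rfl | rfl⟩
  · rw [cchi_even]; simp
  · rw [cchi_odd]; simp

lemma r2_eq_conv (n : ℕ) (hn : n ≠ 0) :
    (r2 n : ℂ) = 4 * (LSeries.convolution 1 cchi) n := by
  rw [LSeries.convolution_def]
  have h := r2_eq_gchi n hn
  have h' : (r2 n : ℂ) = 4 * (gchi n : ℂ) := by exact_mod_cast h
  rw [h', gchi]
  simp only [Pi.one_apply, one_mul]
  rw [Nat.sum_divisorsAntidiagonal' (fun _ j => cchi j)]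
  simp [cchi]

/-- For `Re s > 1`: `(1/4) ∑_{n≥1} r₂(n) n^{-s} = ζ(s) · L(s, χ₄)`, where
`L(s, χ₄) = ∑_{k≥0} (-1)^k (2k+1)^{-s}`; all series converge absolutely. -/
theorem dedekind_zeta_gaussian_factorization (s : ℂ) (hs : 1 < s.re) :
    Summable (fun n : ℕ => ‖(r2 (n + 1) : ℂ) * ((n + 1 : ℕ) : ℂ) ^ (-s)‖) ∧
    Summable (fun n : ℕ => ‖((n + 1 : ℕ) : ℂ) ^ (-s)‖) ∧
    Summable (fun k : ℕ => ‖((-1 : ℂ) ^ k * ((2 * k + 1 : ℕ) : ℂ) ^ (-s))‖) ∧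
    (1 / 4 : ℂ) * ∑' n : ℕ, (r2 (n + 1) : ℂ) * ((n + 1 : ℕ) : ℂ) ^ (-s)
      = riemannZeta s * ∑' k : ℕ, (-1 : ℂ) ^ k * ((2 * k + 1 : ℕ) : ℂ) ^ (-s) := by
  have S1 : LSeriesSummable 1 s := LSeriesSummable_one_iff.mpr hs
  have Sc : LSeriesSummable cchi s :=
    LSeriesSummable_of_bounded_of_one_lt_re (fun n _ => cchi_norm_le n) hs
  have Sv := S1.convolution Sc
  have Lv := LSeries_convolution' S1 Sc
  rw [LSeries_one_eq_riemannZeta hs] at Lv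
  have hsucc : Function.Injective (fun n : ℕ => n + 1) := add_left_injective 1
  have hodd : Function.Injective (fun k : ℕ => 2 * k + 1) := fun a b h => by
    simpa using h
  have t (f : ℕ → ℂ) (n : ℕ) (hn : n ≠ 0) : LSeries.term f s n = f n * (n : ℂ) ^ (-s) := by
    rw [LSeries.term_of_ne_zero hn, cpow_neg, div_eq_mul_inv]
  have tr (n : ℕ) : (r2 (n + 1) : ℂ) * ((n + 1 : ℕ) : ℂ) ^ (-s)
      = 4 * LSeries.term (LSeries.convolution 1 cchi) s (n + 1) := by
    rw [t _ _ n.succ_ne_zero, r2_eq_conv _ n.succ_ne_zero, mul_assoc]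
  have tc (k : ℕ) : (-1 : ℂ) ^ k * ((2 * k + 1 : ℕ) : ℂ) ^ (-s)
      = LSeries.term cchi s (2 * k + 1) := by
    rw [t _ _ (by omega), cchi_odd]
  have t1 (n : ℕ) : ((n + 1 : ℕ) : ℂ) ^ (-s) = LSeries.term 1 s (n + 1) := by
    rw [t _ _ n.succ_ne_zero]; simp
  refine ⟨?_, ?_, ?_, ?_⟩
  · simp_rw [tr]
    exact ((Sv.comp_injective hsucc).mul_left 4).norm
  · simp_rw [t1]
    exact (Summable.comp_injective S1 hsucc).norm
  · simp_rw [tc]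
    exact (Summable.comp_injective Sc hodd).norm
  · simp_rw [tr, tc]
    rw [tsum_mul_left]
    have e1 : ∑' n, LSeries.term (LSeries.convolution 1 cchi) s (n + 1)
        = LSeries (LSeries.convolution 1 cchi) s := by
      refine hsucc.tsum_eq (f := LSeries.term (LSeries.convolution 1 cchi) s) ?_
      intro n hn
      rcases n with _ | n
      · simp at hn
      · exact ⟨n, rfl⟩
    have e2 : ∑' k, LSeries.term cchi s (2 * k + 1) = LSeries cchi s := by
      refine hodd.tsum_eq (f := LSeries.term cchi s) ?_
      intro n hn
      rcases Nat.even_or_odd' n with ⟨k, rfl | rfl⟩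
      · exfalso
        apply hn
        rcases eq_or_ne k 0 with rfl | hk
        · simp
        · rw [t _ _ (by omega), cchi_even, zero_mul]
      · exact ⟨k, rfl⟩
    rw [e1, e2, Lv]
    ring
end

section
/- Let f : ℝ → ℂ be a Schwartz function that vanishes to infinite order at the origin, i.e. f^{(k)}(0) = 0 for every k ≥ 0. Then for every ν ∈ ℂ, the function g defined by g(x) = |x|^ν f(x) for x ≠ 0 and g(0) = 0 is again a Schwartz function on ℝ. -/
open Real Complex

/-- All derivatives vanish at the origin. -/
def FlatAtZero (f : SchwartzMap ℝ ℂ) : Prop := ∀ k : ℕ, iteratedDeriv k (⇑f) 0 = 0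

/-- The Schwartz function `x * f x`. -/
noncomputable def mulX (f : SchwartzMap ℝ ℂ) : SchwartzMap ℝ ℂ :=
  SchwartzMap.smulLeftCLM ℂ (fun x : ℝ => x) f

theorem mulX_apply (f : SchwartzMap ℝ ℂ) (x : ℝ) : mulX f x = (x : ℂ) * f x := by
  unfold mulX
  rw [SchwartzMap.smulLeftCLM_apply_apply (by fun_prop)]
  simp

theorem FlatAtZero.mulX {f : SchwartzMap ℝ ℂ} (hf : FlatAtZero f) : FlatAtZero (mulX f) := by
  intro k
  have h : (⇑(_root_.mulX f)) = (fun x : ℝ => (x : ℂ)) * ⇑f := by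
    funext x
    simp [mulX_apply]
  have h1 : ContDiff ℝ k (fun x : ℝ => (x : ℂ)) := Complex.ofRealCLM.contDiff
  rw [h, iteratedDeriv_mul h1.contDiffAt (f.smooth k).contDiffAt]
  exact Finset.sum_eq_zero fun i _ => by rw [hf, mul_zero]

theorem FlatAtZero.deriv {f : SchwartzMap ℝ ℂ} (hf : FlatAtZero f) :
    FlatAtZero (SchwartzMap.derivCLM ℂ ℂ f) := by
  intro k
  have h : (⇑(SchwartzMap.derivCLM ℂ ℂ f)) = _root_.deriv (⇑f) := rfl
  rw [h, ← iteratedDeriv_succ']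
  exact hf _

theorem FlatAtZero.zero {f : SchwartzMap ℝ ℂ} (hf : FlatAtZero f) : f 0 = 0 := by
  simpa using hf 0

theorem flat_bound (N : ℕ) : ∀ f : SchwartzMap ℝ ℂ, FlatAtZero f →
    ∃ C : ℝ, 0 ≤ C ∧ ∀ x : ℝ, ‖f x‖ ≤ C * |x| ^ N := by
  induction N with
  | zero =>
    intro f _
    obtain ⟨C, hC⟩ := f.decay 0 0
    refine ⟨C, hC.1.le, fun x => ?_⟩
    simpa using hC.2 x
  | succ N ih =>
    intro f hf
    obtain ⟨C, hC0, hC⟩ := ih _ hf.deriv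
    refine ⟨C, hC0, fun x => ?_⟩
    have := Convex.norm_image_sub_le_of_norm_deriv_le (𝕜 := ℝ) (f := ⇑f)
      (s := Metric.closedBall (0 : ℝ) |x|) (C := C * |x| ^ N) (x := 0) (y := x)
      (fun y _ => f.differentiableAt) (fun y hy => ?_) (convex_closedBall _ _) (by simp) (by simp)
    · rw [hf.zero, sub_zero, sub_zero, Real.norm_eq_abs] at this
      rw [pow_succ, ← mul_assoc]
      exact this
    · refine (hC y).trans ?_
      have : |y| ≤ |x| := by simpa using hy
      gcongr

/-- The product `|x|^ν f(x)`. -/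
noncomputable def powMul (ν : ℂ) (f : SchwartzMap ℝ ℂ) (x : ℝ) : ℂ := ((|x| : ℝ) : ℂ) ^ ν * f x

theorem powMul_zero (ν : ℂ) {f : SchwartzMap ℝ ℂ} (hf : FlatAtZero f) : powMul ν f 0 = 0 := by
  simp [powMul, hf.zero]

theorem powMul_decay (ν : ℂ) {f : SchwartzMap ℝ ℂ} (hf : FlatAtZero f) (k : ℕ) :
    ∃ C : ℝ, ∀ x : ℝ, |x| ^ k * ‖powMul ν f x‖ ≤ C := by
  obtain ⟨m, hm⟩ := exists_nat_ge |(k : ℝ) + ν.re|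
  obtain ⟨C, hC0, hC⟩ := flat_bound m f hf
  obtain ⟨D, hD0, hD⟩ := f.decay m 0
  simp only [norm_iteratedFDeriv_zero, Real.norm_eq_abs] at hD
  refine ⟨C + D, fun x => ?_⟩
  rcases eq_or_ne x 0 with rfl | hx
  · rw [powMul_zero ν hf]
    simp
    positivity
  have hx' : 0 < |x| := abs_pos.2 hx
  have e : |x| ^ k * ‖powMul ν f x‖ = |x| ^ ((k : ℝ) + ν.re) * ‖f x‖ := by
    rw [powMul, norm_mul, Complex.norm_cpow_eq_rpow_re_of_pos hx', Real.rpow_add hx',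
      Real.rpow_natCast, mul_assoc]
  rw [e]
  rcases le_total |x| 1 with h1 | h1
  · have : |x| ^ ((k : ℝ) + ν.re) ≤ |x| ^ (-(m : ℝ)) :=
      Real.rpow_le_rpow_of_exponent_ge hx' h1 (by linarith [neg_abs_le ((k : ℝ) + ν.re)])
    calc _ ≤ |x| ^ (-(m : ℝ)) * (C * |x| ^ m) := by
          gcongr
          exact hC x
      _ = C := by
          rw [Real.rpow_neg hx'.le, Real.rpow_natCast]
          field_simp
      _ ≤ _ := by linarith
  · have : |x| ^ ((k : ℝ) + ν.re) ≤ |x| ^ (m : ℝ) :=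
      Real.rpow_le_rpow_of_exponent_le h1 (by linarith [le_abs_self ((k : ℝ) + ν.re)])
    calc _ ≤ |x| ^ (m : ℝ) * ‖f x‖ := by gcongr
      _ ≤ D := by
          rw [Real.rpow_natCast]
          exact hD x
      _ ≤ _ := by linarith

theorem powMul_sub_two (ν : ℂ) (f : SchwartzMap ℝ ℂ) {x : ℝ} (hx : x ≠ 0) :
    powMul (ν - 2) f x * (x : ℂ) ^ 2 = powMul ν f x := by
  have h0 : ((|x| : ℝ) : ℂ) ≠ 0 := by simpa using hx
  have h2 : ((|x| : ℝ) : ℂ) ^ 2 = (x : ℂ) ^ 2 := by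
    rw [← Complex.ofReal_pow, sq_abs, Complex.ofReal_pow]
  have hx' : (x : ℂ) ≠ 0 := by simpa using hx
  rw [powMul, powMul, Complex.cpow_sub _ _ h0]
  rw [show ((|x| : ℝ) : ℂ) ^ (2 : ℂ) = (x : ℂ) ^ 2 by rw [← h2]; norm_cast]
  field_simp

theorem powMul_hasDerivAt (ν : ℂ) {f : SchwartzMap ℝ ℂ} (hf : FlatAtZero f) (x : ℝ) :
    HasDerivAt (powMul ν f)
      (powMul ν (SchwartzMap.derivCLM ℂ ℂ f) x + ν * powMul (ν - 2) (mulX f) x) x := by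
  rcases eq_or_ne x 0 with rfl | hx
  · rw [powMul_zero _ hf.deriv, powMul_zero _ hf.mulX]
    obtain ⟨C, hC⟩ := powMul_decay (ν - 2) hf 0
    have hb : ∀ y : ℝ, ‖powMul ν f y‖ ≤ C * ‖y ^ 2‖ := by
      intro y
      rcases eq_or_ne y 0 with rfl | hy
      · simp [powMul_zero ν hf]
      rw [← powMul_sub_two ν f hy, norm_mul]
      have := hC y
      rw [pow_zero, one_mul] at this
      rw [← Complex.ofReal_pow, Complex.norm_real]
      gcongr
    rw [hasDerivAt_iff_isLittleO]
    simp only [powMul_zero ν hf, sub_zero, mul_zero, add_zero, smul_zero]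
    have h1 : (powMul ν f) =O[nhds 0] (fun y : ℝ => y ^ 2) :=
      Asymptotics.IsBigO.of_bound C (Filter.Eventually.of_forall hb)
    refine h1.trans_isLittleO ?_
    simpa using Asymptotics.isLittleO_pow_pow (𝕜 := ℝ) (m := 1) (n := 2) (by norm_num)
  · have hx' : (x : ℂ) ≠ 0 := by simpa using hx
    have hexp : ∀ y : ℝ, y ≠ 0 → ((|y| : ℝ) : ℂ) ^ ν = Complex.exp ((Real.log y : ℝ) * ν) := by
      intro y hy
      have h0 : ((|y| : ℝ) : ℂ) ≠ 0 := by simpa using hy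
      rw [Complex.cpow_def_of_ne_zero h0, ← Complex.ofReal_log (abs_nonneg y), Real.log_abs]
    have h1 : HasDerivAt (fun y : ℝ => Complex.exp ((Real.log y : ℝ) * ν))
        (Complex.exp ((Real.log x : ℝ) * ν) * (((x⁻¹ : ℝ) : ℂ) * ν)) x :=
      ((Real.hasDerivAt_log hx).ofReal_comp.mul_const ν).cexp
    have h2 := h1.mul (f.hasDerivAt x)
    have h3 : powMul ν f =ᶠ[nhds x] (fun y : ℝ => Complex.exp ((Real.log y : ℝ) * ν)) * ⇑f := by
      filter_upwards [isOpen_ne.mem_nhds hx] with y hy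
      simp [powMul, hexp y hy]
    refine (h2.congr_of_eventuallyEq h3).congr_deriv ?_
    have h4 := powMul_sub_two ν (mulX f) hx
    have h5 : powMul (ν - 2) (mulX f) x = powMul ν (mulX f) x / (x : ℂ) ^ 2 := by
      rw [← h4]
      field_simp
    rw [h5, powMul, powMul, mulX_apply, hexp x hx, SchwartzMap.derivCLM_apply]
    push_cast
    field_simp
    ring

theorem powMul_main (n : ℕ) : ∀ (ν : ℂ) (f : SchwartzMap ℝ ℂ), FlatAtZero f →
    ContDiff ℝ n (powMul ν f) ∧
      ∀ k : ℕ, ∃ C : ℝ, ∀ x : ℝ, |x| ^ k * ‖iteratedDeriv n (powMul ν f) x‖ ≤ C := by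
  induction n with
  | zero =>
    intro ν f hf
    refine ⟨?_, fun k => by simpa using powMul_decay ν hf k⟩
    rw [Nat.cast_zero, contDiff_zero]
    exact continuous_iff_continuousAt.2 fun x => (powMul_hasDerivAt ν hf x).continuousAt
  | succ n ih =>
    intro ν f hf
    have hd : deriv (powMul ν f) = fun x => powMul ν (SchwartzMap.derivCLM ℂ ℂ f) x +
        ν * powMul (ν - 2) (mulX f) x :=
      funext fun x => (powMul_hasDerivAt ν hf x).deriv
    obtain ⟨c1, d1⟩ := ih ν _ hf.deriv
    obtain ⟨c2, d2⟩ := ih (ν - 2) _ hf.mulX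
    have c3 : ContDiff ℝ n (fun x => ν * powMul (ν - 2) (mulX f) x) := contDiff_const.mul c2
    refine ⟨?_, fun k => ?_⟩
    · rw [Nat.cast_succ, contDiff_succ_iff_deriv]
      refine ⟨fun x => (powMul_hasDerivAt ν hf x).differentiableAt, by simp, ?_⟩
      rw [hd]
      exact c1.add c3
    · obtain ⟨C1, h1⟩ := d1 k
      obtain ⟨C2, h2⟩ := d2 k
      refine ⟨C1 + ‖ν‖ * C2, fun x => ?_⟩
      rw [iteratedDeriv_succ', hd, iteratedDeriv_fun_add c1.contDiffAt c3.contDiffAt,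
        iteratedDeriv_const_mul ν c2.contDiffAt]
      calc _ ≤ |x| ^ k * (‖iteratedDeriv n (powMul ν (SchwartzMap.derivCLM ℂ ℂ f)) x‖ +
            ‖ν‖ * ‖iteratedDeriv n (powMul (ν - 2) (mulX f)) x‖) := by
            gcongr
            rw [← norm_mul]
            exact norm_add_le _ _
        _ = |x| ^ k * ‖iteratedDeriv n (powMul ν (SchwartzMap.derivCLM ℂ ℂ f)) x‖ +
            ‖ν‖ * (|x| ^ k * ‖iteratedDeriv n (powMul (ν - 2) (mulX f)) x‖) := by ring
        _ ≤ _ := by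
            gcongr
            · exact h1 x
            · exact h2 x

/-- If the Schwartz function `f` vanishes to infinite order at the origin, then for any
`ν ∈ ℂ` the function `x ↦ |x|^ν f(x)` (with value `0` at `x = 0`) is again Schwartz. -/
theorem abs_rpow_smul_schwartz (f : SchwartzMap ℝ ℂ)
    (hf : ∀ k : ℕ, iteratedDeriv k (⇑f) 0 = 0) (ν : ℂ) :
    ∃ g : SchwartzMap ℝ ℂ,
      (∀ x : ℝ, x ≠ 0 → g x = ((|x| : ℝ) : ℂ) ^ ν * f x) ∧ g 0 = 0 := by
  have hF : FlatAtZero f := hf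
  refine ⟨⟨powMul ν f, contDiff_infty.2 fun n => (powMul_main n ν f hF).1, fun k n => ?_⟩,
    fun x _ => rfl, powMul_zero ν hF⟩
  obtain ⟨C, hC⟩ := (powMul_main n ν f hF).2 k
  refine ⟨C, fun x => ?_⟩
  rw [norm_iteratedFDeriv_eq_norm_iteratedDeriv]
  exact hC x
end
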